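/- arXiv:2407.19999 — 3 statements merged into one kernel-verified Lean document; each statement's English description precedes it below -/
import Mathlib

section
/- Let R be a Cohen–Macaulay local ring of Cohen–Macaulay type 2 with canonical module ω, Gorenstein on the punctured spectrum, of dimension d ≥ 2. Then the stable annihilator of ω equals the Auslander–Reiten annihilator of ω. -/
open CategoryTheory Opposite IsLocalRing

universe u

variable (R : Type u) [CommRing R]

/-- The Ext module `Ext^i_R(M, N)` as an object of `ModuleCat R`. -/
noncomputable def ExtMod (i : ℕ) (M N : Type u) [AddCommGroup M] [Module R M]
    [AddCommGroup N] [Module R N] : ModuleCat.{u} R :=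
  ((Ext R (ModuleCat.{u} R) i).obj (op (ModuleCat.of R M))).obj (ModuleCat.of R N)

/-- The annihilator of `Ext^i_R(M, N)`. -/
noncomputable def extAnn (i : ℕ) (M N : Type u) [AddCommGroup M] [Module R M]
    [AddCommGroup N] [Module R N] : Ideal R :=
  Module.annihilator R (ExtMod R i M N)

/-- `S` is a (first) syzygy of `M`: the kernel of a surjection from a
finitely generated free module onto `M`. -/
def IsSyzygy (M S : Type u) [AddCommGroup M] [Module R M] [AddCommGroup S] [Module R S] : Prop :=
  ∃ (F : Type u) (_ : AddCommGroup F) (_ : Module R F) (ι : S →ₗ[R] F) (π : F →ₗ[R] M),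
    Module.Free R F ∧ Module.Finite R F ∧ Function.Injective ι ∧ Function.Surjective π ∧
      LinearMap.range ι = LinearMap.ker π

/-- The submodule of `Hom_R(M,N)` of maps factoring through a free module. -/
def stablyTrivial (M N : Type u) [AddCommGroup M] [Module R M] [AddCommGroup N] [Module R N] :
    Submodule R (M →ₗ[R] N) :=
  Submodule.span R {f : M →ₗ[R] N | ∃ (F : Type u) (_ : AddCommGroup F) (_ : Module R F),
    Module.Free R F ∧ ∃ (g : M →ₗ[R] F) (h : F →ₗ[R] N), h ∘ₗ g = f}

/-- The stable annihilator of `M`: the annihilator of `End_R(M)/P(M,M)`. -/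
noncomputable def stableAnn (M : Type u) [AddCommGroup M] [Module R M] : Ideal R :=
  Module.annihilator R ((M →ₗ[R] M) ⧸ stablyTrivial R M M)

/-- The Auslander–Reiten annihilator `⋂_{i>0} ann Ext^i(M, M ⊕ R)`. -/
noncomputable def ARann (M : Type u) [AddCommGroup M] [Module R M] : Ideal R :=
  ⨅ i : ℕ, extAnn R (i + 1) M (M × R)

/-- Depth of a module over a local ring: supremum of lengths of regular sequences
contained in the maximal ideal. -/
noncomputable def moduleDepth [IsLocalRing R] (M : Type u) [AddCommGroup M] [Module R M] : ℕ∞ :=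
  sSup {n : ℕ∞ | ∃ rs : List R, (∀ r ∈ rs, r ∈ maximalIdeal R) ∧
    RingTheory.Sequence.IsRegular M rs ∧ (rs.length : ℕ∞) = n}

/-- `ω` is a canonical module of the `d`-dimensional Cohen-Macaulay local ring `R`:
it is finitely generated and `Ext^i(k, ω)` vanishes for `i ≠ d` and is `k` for `i = d`. -/
def IsCanonicalModule [IsLocalRing R] (d : ℕ) (ω : Type u) [AddCommGroup ω] [Module R ω] :
    Prop :=
  Module.Finite R ω ∧
    (∀ i : ℕ, i ≠ d → Subsingleton (ExtMod R i (ResidueField R) ω)) ∧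
    Nonempty ((ExtMod R d (ResidueField R) ω) ≃ₗ[R] ResidueField R)

/-- A Gorenstein local ring: Noetherian local, and the ring itself is a canonical module. -/
def IsGorensteinLocal (A : Type u) [CommRing A] [IsLocalRing A] : Prop :=
  IsNoetherianRing A ∧ ∃ d : ℕ, ringKrullDim A = d ∧ IsCanonicalModule A d A

/-- A regular local ring: Noetherian local whose maximal ideal is generated by
`dim` elements. -/
def IsRegularLocal (A : Type u) [CommRing A] [IsLocalRing A] : Prop :=
  IsNoetherianRing A ∧ ∃ (d : ℕ) (s : Finset A), ringKrullDim A = (d : ℕ) ∧ s.card = d ∧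
    Ideal.span (s : Set A) = maximalIdeal A

/-- `S` is an `n`-th syzygy of `M`. -/
def IsNthSyzygy : (n : ℕ) → ∀ (M S : Type u) [AddCommGroup M] [Module R M]
    [AddCommGroup S] [Module R S], Prop
  | 0 => fun M S _ _ _ _ => Nonempty (M ≃ₗ[R] S)
  | n + 1 => fun M S _ _ _ _ => ∃ (T : Type u) (_ : AddCommGroup T) (_ : Module R T),
      IsSyzygy R M T ∧ IsNthSyzygy n T S

/-- Maximal Cohen-Macaulay module: finitely generated with depth equal to the
Krull dimension of the ring. -/
def IsMCM [IsLocalRing R] (M : Type u) [AddCommGroup M] [Module R M] : Prop :=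
  Module.Finite R M ∧ (moduleDepth R M : WithBot ℕ∞) = ringKrullDim R

/-- The trace ideal of a module. -/
def traceIdeal (M : Type u) [AddCommGroup M] [Module R M] : Ideal R :=
  ⨆ f : M →ₗ[R] R, LinearMap.range f

section Bridge

variable {R : Type u} [CommRing R]

open ProjectiveResolution CochainComplex HomComplex in
theorem extMk_zero_deg_eq_zero {X Y : ModuleCat.{u} R} (P : ProjectiveResolution X)
    (f : P.complex.X 0 ⟶ Y) (hf : P.complex.d 1 0 ≫ f = 0)
    (h : P.extMk f 1 rfl hf = 0) : f = 0 := by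
  simp only [← P.extEquivCohomologyClass.apply_eq_iff_eq,
    extEquivCohomologyClass_extMk, extEquivCohomologyClass_zero,
    CohomologyClass.mk_eq_zero_iff] at h
  rw [Cocycle.toSingleMk_mem_coboundaries_iff _ _ _ _ _ 1 (by lia)] at h
  obtain ⟨g, hg⟩ := h
  have hz : Limits.IsZero (P.cochainComplex.X 1) := P.cochainComplex.isZero_of_isStrictlyLE 0 1
  rw [hz.eq_of_src g 0, Limits.comp_zero] at hg
  rw [← cancel_epi (P.cochainComplexXIso (-(0:ℕ)) 0 rfl).hom]
  rw [Limits.comp_zero]; exact hg.symm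

theorem smul_extMk_aux {X Y : ModuleCat.{u} R} (P : ProjectiveResolution X) (n : ℕ)
    (f : P.complex.X n ⟶ Y) (r : R) (hf : P.complex.d (n+1) n ≫ f = 0)
    (hf' : P.complex.d (n+1) n ≫ (r • f) = 0) :
    P.extMk (r • f) (n+1) rfl hf' = r • P.extMk f (n+1) rfl hf := by
  rw [Abelian.Ext.smul_eq_comp_mk₀, P.extMk_comp_mk₀]
  simp only [Linear.comp_smul, Category.comp_id]

/-- comparison of the derived functor `Ext` with `Abelian.Ext`. -/
theorem ext_bridge_aux {X Y : ModuleCat.{u} R} (n : ℕ) :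
    Nonempty (((Ext R (ModuleCat.{u} R) n).obj (op X)).obj Y ≃ₗ[R] Abelian.Ext X Y n) := by
  let P : ProjectiveResolution X := projectiveResolution X
  let C := P.complex.linearYonedaObj R Y
  let e₁ : ((Ext R (ModuleCat.{u} R) n).obj (op X)).obj Y ≃ₗ[R]
    (C.sc n).moduleCatLeftHomologyData.H :=
    ((P.isoExt n Y) ≪≫ (C.sc n).moduleCatHomologyIso).toLinearEquiv
  suffices h : Nonempty (((C.sc n).moduleCatLeftHomologyData.H) ≃ₗ[R] Abelian.Ext X Y n) from
    h.map fun e => e₁.trans e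
  have hnext : (ComplexShape.up ℕ).next n = n + 1 := by simp
  have hker : ∀ z : LinearMap.ker (C.sc n).g.hom, P.complex.d (n+1) n ≫ (z.1 : P.complex.X n ⟶ Y) = 0 := by
    intro z
    have := z.2
    rw [LinearMap.mem_ker] at this
    have h2 : C.dTo n = C.dTo n := rfl
    have h3 : (C.d n (n+1)).hom z.1 = 0 := by
      rw [← hnext]; exact this
    exact h3
  let q : LinearMap.ker (C.sc n).g.hom →ₗ[R] Abelian.Ext X Y n :=
    { toFun := fun z => P.extMk z.1 (n+1) rfl (hker z)
      map_add' := fun z w => (P.add_extMk _ _ _ _ _ _).symm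
      map_smul' := fun r z => by
        exact smul_extMk_aux P n _ r (hker z) _ }
  have hq : Function.Surjective q := by
    intro α
    obtain ⟨f, hf, rfl⟩ := P.extMk_surjective α (n+1) rfl
    have h3 : (C.d n (n+1)).hom f = 0 := hf
    rw [← hnext] at h3
    exact ⟨⟨f, LinearMap.mem_ker.2 h3⟩, rfl⟩
  have hqk : LinearMap.ker q = LinearMap.range (C.sc n).moduleCatToCycles := by
    ext z
    rw [LinearMap.mem_ker, LinearMap.mem_range]
    rcases n with _ | p
    · have hd : (C.sc 0).f = 0 := C.shape _ _ (by simp)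
      constructor
      · intro h
        have := extMk_zero_deg_eq_zero P _ (hker z) h
        refine ⟨0, ?_⟩
        rw [map_zero]
        exact (Subtype.ext this).symm
      · rintro ⟨w, rfl⟩
        have : (C.sc 0).moduleCatToCycles w = 0 := by
          apply Subtype.ext
          change (C.sc 0).f.hom w = 0
          rw [hd]; rfl
        rw [this, map_zero]
    · have hprev : (ComplexShape.up ℕ).prev (p+1) = p := by simp
      refine (P.extMk_eq_zero_iff _ _ rfl (hker z) p rfl).trans ?_
      have key : (∃ g : C.X ((ComplexShape.up ℕ).prev (p+1)), (C.d ((ComplexShape.up ℕ).prev (p+1)) (p+1)).hom g = z.1) ↔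
         ∃ g : C.X p, (C.d p (p+1)).hom g = z.1 := by rw [hprev]
      constructor
      · rintro ⟨g, hg⟩
        obtain ⟨g', hg'⟩ := key.2 ⟨g, hg⟩
        exact ⟨g', Subtype.ext hg'⟩
      · rintro ⟨g, hg⟩
        obtain ⟨g', hg'⟩ := key.1 ⟨g, congrArg Subtype.val hg⟩
        exact ⟨g', hg'⟩
  exact ⟨(Submodule.quotEquivOfEq _ _ hqk.symm).trans (q.quotKerEquivOfSurjective hq)⟩

end Bridge

section API

variable {R : Type u} [CommRing R]

/-- `Abelian.Ext` between unbundled modules. -/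
abbrev XE (R : Type u) [CommRing R] (M N : Type u) [AddCommGroup M] [Module R M]
    [AddCommGroup N] [Module R N] (i : ℕ) : Type u :=
  Abelian.Ext.{u} (ModuleCat.of R M) (ModuleCat.of R N) i

/-- short exact sequences -/
structure SES {A B C : Type u} [AddCommGroup A] [Module R A] [AddCommGroup B] [Module R B]
    [AddCommGroup C] [Module R C] (f : A →ₗ[R] B) (g : B →ₗ[R] C) : Prop where
  inj : Function.Injective f
  ex : Function.Exact f g
  surj : Function.Surjective g

variable {A B C M N L : Type u} [AddCommGroup A] [Module R A] [AddCommGroup B] [Module R B]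
    [AddCommGroup C] [Module R C] [AddCommGroup M] [Module R M] [AddCommGroup N] [Module R N]
    [AddCommGroup L] [Module R L]

theorem nonempty_extMod (i : ℕ) : Nonempty (ExtMod R i M N ≃ₗ[R] XE R M N i) :=
  ext_bridge_aux i

theorem mem_extAnn {i : ℕ} {a : R} : a ∈ extAnn R i M N ↔ ∀ x : XE R M N i, a • x = 0 := by
  obtain ⟨e⟩ := nonempty_extMod (R := R) (M := M) (N := N) i
  unfold extAnn
  rw [e.annihilator_eq, Module.mem_annihilator]

theorem SES.mk_zero {f : A →ₗ[R] B} {g : B →ₗ[R] C} (h : SES f g) :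
    ModuleCat.ofHom f ≫ ModuleCat.ofHom g = 0 := by
  ext x
  simpa using h.ex.apply_apply_eq_zero x

/-- bundled version -/
abbrev SES.sc {f : A →ₗ[R] B} {g : B →ₗ[R] C} (h : SES f g) : ShortComplex (ModuleCat.{u} R) :=
  ShortComplex.mk (ModuleCat.ofHom f) (ModuleCat.ofHom g) h.mk_zero

theorem SES.se {f : A →ₗ[R] B} {g : B →ₗ[R] C} (h : SES f g) : h.sc.ShortExact where
  exact := by
    rw [ShortComplex.ShortExact.moduleCat_exact_iff_function_exact]
    exact h.ex
  mono_f := (ModuleCat.mono_iff_injective _).2 h.inj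
  epi_g := (ModuleCat.epi_iff_surjective _).2 h.surj

theorem SES.of_submodule (P : Submodule R M) : SES P.subtype P.mkQ where
  inj := P.injective_subtype
  ex := LinearMap.exact_subtype_mkQ P
  surj := P.mkQ_surjective

theorem SES.of_surj {g : B →ₗ[R] C} (hg : Function.Surjective g) :
    SES (LinearMap.ker g).subtype g where
  inj := Submodule.injective_subtype _
  ex := LinearMap.exact_subtype_ker_map g
  surj := hg

namespace XE

variable (N) in
/-- contravariant functoriality -/
noncomputable def pre (f : A →ₗ[R] B) (i : ℕ) : XE R B N i →ₗ[R] XE R A N i :=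
  (Abelian.Ext.mk₀ (ModuleCat.ofHom f)).precompOfLinear R _ (zero_add i)

variable (M) in
/-- covariant functoriality -/
noncomputable def post (f : A →ₗ[R] B) (i : ℕ) : XE R M A i →ₗ[R] XE R M B i :=
  (Abelian.Ext.mk₀ (ModuleCat.ofHom f)).postcompOfLinear R _ (add_zero i)

variable (N) in
/-- contravariant connecting map -/
noncomputable def dc {f : A →ₗ[R] B} {g : B →ₗ[R] C} (h : SES f g) (i : ℕ) :
    XE R A N i →ₗ[R] XE R C N (i + 1) :=
  h.se.extClass.precompOfLinear R _ (add_comm 1 i)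

variable (M) in
/-- covariant connecting map -/
noncomputable def dv {f : A →ₗ[R] B} {g : B →ₗ[R] C} (h : SES f g) (i : ℕ) :
    XE R M C i →ₗ[R] XE R M A (i + 1) :=
  h.se.extClass.postcompOfLinear R _ rfl

theorem pre_apply (f : A →ₗ[R] B) (i : ℕ) (x : XE R B N i) :
    pre N f i x = (Abelian.Ext.mk₀ (ModuleCat.ofHom f)).comp x (zero_add i) := rfl

theorem post_apply (f : A →ₗ[R] B) (i : ℕ) (x : XE R M A i) :
    post M f i x = x.comp (Abelian.Ext.mk₀ (ModuleCat.ofHom f)) (add_zero i) := rfl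

theorem dc_apply {f : A →ₗ[R] B} {g : B →ₗ[R] C} (h : SES f g) (i : ℕ) (x : XE R A N i) :
    dc N h i x = h.se.extClass.comp x (add_comm 1 i) := rfl

theorem dv_apply {f : A →ₗ[R] B} {g : B →ₗ[R] C} (h : SES f g) (i : ℕ) (x : XE R M C i) :
    dv M h i x = x.comp h.se.extClass rfl := rfl

theorem pre_comp (f : A →ₗ[R] B) (g : B →ₗ[R] C) (i : ℕ) (x : XE R C N i) :
    pre N (g ∘ₗ f) i x = pre N f i (pre N g i x) := by
  simp only [pre_apply, ModuleCat.ofHom_comp, ← Abelian.Ext.mk₀_comp_mk₀]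
  exact Abelian.Ext.comp_assoc_of_second_deg_zero ..

theorem post_comp (f : A →ₗ[R] B) (g : B →ₗ[R] C) (i : ℕ) (x : XE R M A i) :
    post M (g ∘ₗ f) i x = post M g i (post M f i x) := by
  simp only [post_apply, ModuleCat.ofHom_comp, ← Abelian.Ext.mk₀_comp_mk₀]
  exact (Abelian.Ext.comp_assoc_of_second_deg_zero ..).symm

theorem pre_post (f : A →ₗ[R] B) (g : M →ₗ[R] N) (i : ℕ) (x : XE R B M i) :
    pre N f i (post B g i x) = post A g i (pre M f i x) := by
  simp only [pre_apply, post_apply]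
  symm
  exact Abelian.Ext.comp_assoc_of_third_deg_zero ..

theorem pre_dv {f : A →ₗ[R] B} {g : B →ₗ[R] C} (h : SES f g) (φ : M →ₗ[R] N) (i : ℕ)
    (x : XE R N C i) : pre A φ (i+1) (dv N h i x) = dv M h i (pre C φ i x) := by
  simp only [pre_apply, dv_apply]
  symm
  exact Abelian.Ext.comp_assoc _ _ _ _ _ (by omega)

theorem pre_smul_id (a : R) (i : ℕ) (x : XE R M N i) :
    pre N (a • (LinearMap.id : M →ₗ[R] M)) i x = a • x := by
  have : ModuleCat.ofHom (a • (LinearMap.id : M →ₗ[R] M)) = a • 𝟙 (ModuleCat.of R M) := rfl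
  rw [pre_apply, this, Abelian.Ext.mk₀_smul, Abelian.Ext.smul_comp, Abelian.Ext.mk₀_id_comp]

theorem pre_id (i : ℕ) (x : XE R M N i) : pre N (LinearMap.id : M →ₗ[R] M) i x = x := by
  simpa using pre_smul_id (1 : R) i x

theorem post_smul_id (a : R) (i : ℕ) (x : XE R M N i) :
    post M (a • (LinearMap.id : N →ₗ[R] N)) i x = a • x := by
  rw [Abelian.Ext.smul_eq_comp_mk₀]; rfl

theorem post_id (i : ℕ) (x : XE R M N i) : post M (LinearMap.id : N →ₗ[R] N) i x = x := by
  simpa using post_smul_id (1 : R) i x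

theorem smul_eq_zero_of_ann_left {a : R} (h : ∀ m : M, a • m = 0) {i : ℕ} (x : XE R M N i) :
    a • x = 0 := by
  rw [← pre_smul_id]
  have : a • (LinearMap.id : M →ₗ[R] M) = 0 := by ext m; simpa using h m
  rw [this, pre_apply]
  have : ModuleCat.ofHom (0 : M →ₗ[R] M) = 0 := rfl
  rw [this]; simp

section exact

variable {f : A →ₗ[R] B} {g : B →ₗ[R] C}

theorem exc₁ (h : SES f g) (i : ℕ) : Function.Exact (pre N f i) (dc N h i) := fun x =>
  ⟨fun hx => Abelian.Ext.contravariant_sequence_exact₁ h.se _ x (add_comm 1 i) hx, by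
    rintro ⟨y, rfl⟩
    rw [dc_apply, pre_apply, ← Abelian.Ext.comp_assoc_of_second_deg_zero]
    have := h.se.extClass_comp
    erw [this]
    simp⟩

theorem exc₂ (h : SES f g) (i : ℕ) : Function.Exact (pre N g i) (pre N f i) := fun x =>
  ⟨fun hx => Abelian.Ext.contravariant_sequence_exact₂ h.se _ x hx, by
    rintro ⟨y, rfl⟩
    rw [← pre_comp, h.ex.linearMap_comp_eq_zero, pre_apply]
    have : ModuleCat.ofHom (0 : A →ₗ[R] C) = 0 := rfl
    rw [this]; simp⟩

theorem exc₃ (h : SES f g) (i : ℕ) : Function.Exact (dc N h i) (pre N g (i+1)) := fun x =>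
  ⟨fun hx => Abelian.Ext.contravariant_sequence_exact₃ h.se _ x hx (add_comm 1 i), by
    rintro ⟨y, rfl⟩
    rw [dc_apply, pre_apply, ← Abelian.Ext.comp_assoc _ _ _ (zero_add 1) _ (by omega)]
    have := h.se.comp_extClass
    erw [this]
    simp⟩

theorem exv₂ (h : SES f g) (i : ℕ) : Function.Exact (post M f i) (post M g i) := fun x =>
  ⟨fun hx => Abelian.Ext.covariant_sequence_exact₂ _ h.se x hx, by
    rintro ⟨y, rfl⟩
    rw [← post_comp, h.ex.linearMap_comp_eq_zero, post_apply]
    have : ModuleCat.ofHom (0 : A →ₗ[R] C) = 0 := rfl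
    rw [this]; simp⟩

theorem exv₃ (h : SES f g) (i : ℕ) : Function.Exact (post M g i) (dv M h i) := fun x =>
  ⟨fun hx => Abelian.Ext.covariant_sequence_exact₃ _ h.se x rfl hx, by
    rintro ⟨y, rfl⟩
    rw [dv_apply, post_apply, Abelian.Ext.comp_assoc_of_second_deg_zero]
    have := h.se.comp_extClass
    erw [this]
    simp⟩

theorem exv₁ (h : SES f g) (i : ℕ) : Function.Exact (dv M h i) (post M f (i+1)) := fun x =>
  ⟨fun hx => Abelian.Ext.covariant_sequence_exact₁ _ h.se x hx rfl, by
    rintro ⟨y, rfl⟩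
    rw [dv_apply, post_apply, Abelian.Ext.comp_assoc _ _ _ _ (add_zero 1) (by omega)]
    have := h.se.extClass_comp
    erw [this]
    simp⟩

end exact

/-- degree zero -/
noncomputable def zeroEquiv : XE R M N 0 ≃ₗ[R] (M →ₗ[R] N) :=
  (Abelian.Ext.linearEquiv₀ (R := R)).trans ModuleCat.homLinearEquiv

theorem zeroEquiv_symm (φ : M →ₗ[R] N) :
    zeroEquiv.symm φ = Abelian.Ext.mk₀ (ModuleCat.ofHom φ) := rfl

theorem pre_zero (f : A →ₗ[R] B) (φ : B →ₗ[R] N) :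
    pre N f 0 (zeroEquiv.symm φ) = zeroEquiv.symm (φ ∘ₗ f) := by
  simp [zeroEquiv_symm, pre_apply]

theorem post_zero (f : A →ₗ[R] B) (φ : M →ₗ[R] A) :
    post M f 0 (zeroEquiv.symm φ) = zeroEquiv.symm (f ∘ₗ φ) := by
  simp [zeroEquiv_symm, post_apply]

instance projective_van [Module.Projective R M] (i : ℕ) : Subsingleton (XE R M N (i+1)) := by
  have : Projective (ModuleCat.of R M) := (IsProjective.iff_projective M).1 inferInstance
  exact ⟨fun a b => (Abelian.Ext.eq_zero_of_projective a).trans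
    (Abelian.Ext.eq_zero_of_projective b).symm⟩

instance fin [IsNoetherianRing R] [Module.Finite R M] [Module.Finite R N] (i : ℕ) :
    Module.Finite R (XE R M N i) := ModuleCat.finite_ext R _ _ i

/-- invariance -/
theorem pre_bij (e : A ≃ₗ[R] B) (i : ℕ) : Function.Bijective (pre N e.toLinearMap i) := by
  refine Function.bijective_iff_has_inverse.2 ⟨pre N e.symm.toLinearMap i, fun x => ?_, fun x => ?_⟩
  · rw [← pre_comp]; simp [pre_id]
  · rw [← pre_comp]; simp [pre_id]

theorem post_bij (e : A ≃ₗ[R] B) (i : ℕ) : Function.Bijective (post M e.toLinearMap i) := by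
  refine Function.bijective_iff_has_inverse.2 ⟨post M e.symm.toLinearMap i, fun x => ?_, fun x => ?_⟩
  · rw [← post_comp]; simp [post_id]
  · rw [← post_comp]; simp [post_id]

theorem van_left (e : A ≃ₗ[R] B) {i : ℕ} (h : Subsingleton (XE R A N i)) :
    Subsingleton (XE R B N i) := (pre_bij (N := N) e i).1.subsingleton

theorem van_right (e : A ≃ₗ[R] B) {i : ℕ} (h : Subsingleton (XE R M A i)) :
    Subsingleton (XE R M B i) := (post_bij (M := M) e i).2.subsingleton

theorem sub_of_exact {X Y Z : Type u} [AddCommGroup X] [Module R X] [AddCommGroup Y] [Module R Y]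
    [AddCommGroup Z] [Module R Z] {α : X →ₗ[R] Y} {β : Y →ₗ[R] Z} (h : Function.Exact α β)
    (hx : Subsingleton X) (hz : Subsingleton Z) : Subsingleton Y := by
  refine subsingleton_of_forall_eq 0 fun y => ?_
  obtain ⟨x, rfl⟩ := (h y).1 (Subsingleton.elim _ _)
  rw [Subsingleton.elim x 0, map_zero]

theorem inj_of_exact {X Y Z : Type u} [AddCommGroup X] [Module R X] [AddCommGroup Y] [Module R Y]
    [AddCommGroup Z] [Module R Z] {α : X →ₗ[R] Y} {β : Y →ₗ[R] Z} (h : Function.Exact α β)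
    (hx : Subsingleton X) : Function.Injective β := by
  rw [injective_iff_map_eq_zero]
  intro y hy
  obtain ⟨x, rfl⟩ := (h y).1 hy
  rw [Subsingleton.elim x 0, map_zero]

theorem surj_of_exact {X Y Z : Type u} [AddCommGroup X] [Module R X] [AddCommGroup Y] [Module R Y]
    [AddCommGroup Z] [Module R Z] {α : X →ₗ[R] Y} {β : Y →ₗ[R] Z} (h : Function.Exact α β)
    (hx : Subsingleton Z) : Function.Surjective α := by
  intro y
  exact (h y).1 (Subsingleton.elim _ _)

end XE

end API

section Devissage

variable {R : Type u} [CommRing R] [IsLocalRing R]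

theorem simple_equiv_residue (Q : Type u) [AddCommGroup Q] [Module R Q] [h : IsSimpleModule R Q] :
    Nonempty (Q ≃ₗ[R] ResidueField R) := by
  obtain ⟨I, hI, ⟨e⟩⟩ := isSimpleModule_iff_quot_maximal.1 h
  obtain rfl := IsLocalRing.eq_maximalIdeal hI
  exact ⟨e⟩

theorem fl_van {N : Type u} [AddCommGroup N] [Module R N] {i : ℕ}
    (h : Subsingleton (XE R (ResidueField R) N i)) {L : Type u} [AddCommGroup L] [Module R L]
    (hL : IsFiniteLength R L) : Subsingleton (XE R L N i) := by
  induction hL with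
  | @of_subsingleton M _ _ _ =>
    exact ⟨fun x y => by
      have hz : ∀ m : M, (1 : R) • m = 0 := fun m => Subsingleton.elim _ _
      have h1 := XE.smul_eq_zero_of_ann_left hz x
      have h2 := XE.smul_eq_zero_of_ann_left hz y
      rw [one_smul] at h1 h2
      rw [h1, h2]⟩
  | @of_simple_quotient M _ _ P _ _ ih =>
    obtain ⟨e⟩ := simple_equiv_residue (R := R) (M ⧸ P)
    exact XE.sub_of_exact (XE.exc₂ (N := N) (SES.of_submodule P) i) (XE.van_left e.symm h) ih

theorem fl_submodule {L : Type u} [AddCommGroup L] [Module R L]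
    (hL : IsFiniteLength R L) (P : Submodule R L) : IsFiniteLength R P :=
  hL.of_injective (f := P.subtype) P.injective_subtype

theorem fl_quotient {L : Type u} [AddCommGroup L] [Module R L]
    (hL : IsFiniteLength R L) (P : Submodule R L) : IsFiniteLength R (L ⧸ P) :=
  hL.of_surjective (f := P.mkQ) P.mkQ_surjective

/-- a nonzero module of finite length maps onto the residue field -/
theorem exists_surj_residue {L : Type u} [AddCommGroup L] [Module R L] [Module.Finite R L]
    [Nontrivial L] : ∃ f : L →ₗ[R] ResidueField R, Function.Surjective f := by
  obtain ⟨P, hP⟩ := IsCoatomic.exists_coatom (Submodule R L)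
  have : IsSimpleModule R (L ⧸ P) := isSimpleModule_iff_isCoatom.2 hP
  obtain ⟨e⟩ := simple_equiv_residue (R := R) (L ⧸ P)
  exact ⟨e.toLinearMap ∘ₗ P.mkQ, e.surjective.comp P.mkQ_surjective⟩

theorem fl_ext_zero {N : Type u} [AddCommGroup N] [Module R N] {e : ℕ}
    (h0 : Subsingleton (XE R (ResidueField R) N e))
    (h1 : ¬ Subsingleton (XE R (ResidueField R) N (e+1)))
    {L : Type u} [AddCommGroup L] [Module R L] (hL : IsFiniteLength R L)
    (hX : Subsingleton (XE R L N (e+1))) : Subsingleton L := by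
  by_contra hns
  rw [not_subsingleton_iff_nontrivial] at hns
  have := (isFiniteLength_iff_isNoetherian_isArtinian.1 hL).1
  obtain ⟨f, hf⟩ := exists_surj_residue (R := R) (L := L)
  refine h1 ?_
  exact XE.sub_of_exact (XE.exc₃ (N := N) (SES.of_surj hf) e) (fl_van h0 (fl_submodule hL _)) hX

theorem fl_ann {N : Type u} [AddCommGroup N] [Module R N] {e : ℕ}
    (h0 : Subsingleton (XE R (ResidueField R) N e))
    (h1 : ¬ Subsingleton (XE R (ResidueField R) N (e+1)))
    (h2 : Subsingleton (XE R (ResidueField R) N (e+2)))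
    {L : Type u} [AddCommGroup L] [Module R L] (hL : IsFiniteLength R L) {a : R}
    (ha : ∀ x : XE R L N (e+1), a • x = 0) (l : L) : a • l = 0 := by
  let μ : L →ₗ[R] L := a • LinearMap.id
  have hr : Subsingleton (LinearMap.range μ) := by
    refine fl_ext_zero h0 h1 (fl_submodule hL _) ?_
    have s1 : Function.Surjective (XE.pre N (LinearMap.range μ).subtype (e+1)) :=
      XE.surj_of_exact (XE.exc₁ (N := N) (SES.of_submodule (LinearMap.range μ)) (e+1))
        (fl_van h2 (fl_quotient hL _))
    have s2 : Function.Injective (XE.pre N μ.rangeRestrict (e+1)) :=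
      XE.inj_of_exact (XE.exc₃ (N := N) (SES.of_surj μ.surjective_rangeRestrict) e)
        (fl_van h0 (fl_submodule hL _))
    refine subsingleton_of_forall_eq 0 fun y => ?_
    obtain ⟨x, rfl⟩ := s1 y
    apply s2
    rw [← XE.pre_comp, map_zero]
    have : (LinearMap.range μ).subtype ∘ₗ μ.rangeRestrict = a • LinearMap.id := by
      ext; rfl
    rw [this, XE.pre_smul_id, ha]
  have := congrArg Subtype.val (Subsingleton.elim (⟨μ l, l, rfl⟩ : LinearMap.range μ) 0)
  simpa [μ] using this

theorem fl_length {N : Type u} [AddCommGroup N] [Module R N] {e : ℕ}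
    (h0 : Subsingleton (XE R (ResidueField R) N e))
    (h1 : Nonempty (XE R (ResidueField R) N (e+1) ≃ₗ[R] ResidueField R))
    (h2 : Subsingleton (XE R (ResidueField R) N (e+2)))
    {L : Type u} [AddCommGroup L] [Module R L] (hL : IsFiniteLength R L) :
    Module.length R (XE R L N (e+1)) = Module.length R L := by
  have key := hL
  induction key with
  | @of_subsingleton M _ _ _ =>
    have : Subsingleton (XE R M N (e+1)) := ⟨fun x y => by
      have hz : ∀ m : M, (1 : R) • m = 0 := fun m => Subsingleton.elim _ _
      have h1 := XE.smul_eq_zero_of_ann_left hz x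
      have h2 := XE.smul_eq_zero_of_ann_left hz y
      rw [one_smul] at h1 h2
      rw [h1, h2]⟩
    rw [Module.length_eq_zero, Module.length_eq_zero]
  | @of_simple_quotient M _ _ P _ hP ih =>
    obtain ⟨q⟩ := simple_equiv_residue (R := R) (M ⧸ P)
    have hQ : IsFiniteLength R (M ⧸ P) := fl_quotient hL _
    have e1 : Module.length R (XE R M N (e+1)) =
        Module.length R (XE R (M ⧸ P) N (e+1)) + Module.length R (XE R P N (e+1)) :=
      Module.length_eq_add_of_exact (XE.pre N P.mkQ (e+1)) (XE.pre N P.subtype (e+1))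
        (XE.inj_of_exact (XE.exc₃ (N := N) (SES.of_submodule P) e) (fl_van h0 hP))
        (XE.surj_of_exact (XE.exc₁ (N := N) (SES.of_submodule P) (e+1)) (fl_van h2 hQ))
        (XE.exc₂ (N := N) (SES.of_submodule P) (e+1))
    have e2 : Module.length R M = Module.length R P + Module.length R (M ⧸ P) :=
      Module.length_eq_add_of_exact P.subtype P.mkQ P.injective_subtype P.mkQ_surjective
        (LinearMap.exact_subtype_mkQ P)
    have e3 : Module.length R (XE R (M ⧸ P) N (e+1)) = Module.length R (M ⧸ P) := by
      obtain ⟨k⟩ := h1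
      rw [q.length_eq, ← k.length_eq]
      exact (LinearEquiv.ofBijective _ (XE.pre_bij (N := N) q (e+1))).symm.length_eq
    rw [e1, e2, e3, ih hP, add_comm]

end Devissage

section PF

variable {R : Type u} [CommRing R] [IsNoetherianRing R] [IsLocalRing R]

theorem fl_of_ann {M : Type u} [AddCommGroup M] [Module R M] [Module.Finite R M] (J : Ideal R)
    (hJ : ∀ j ∈ J, ∀ m : M, j • m = 0)
    (hp : ∀ q : Ideal R, q.IsPrime → J ≤ q → q = maximalIdeal R) : IsFiniteLength R M := by
  rw [isFiniteLength_iff_isNoetherian_isArtinian]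
  refine ⟨inferInstance, ?_⟩
  have : Ring.KrullDimLE 0 (R ⧸ J) := by
    refine Ring.krullDimLE_zero_iff.2 fun I hI => ?_
    have h1 : (I.comap (Ideal.Quotient.mk J)).IsPrime := inferInstance
    have h2 : J ≤ I.comap (Ideal.Quotient.mk J) := by
      intro j hj
      rw [Ideal.mem_comap, Ideal.Quotient.eq_zero_iff_mem.2 hj]
      exact I.zero_mem
    have h3 := hp _ h1 h2
    have h4 : (I.comap (Ideal.Quotient.mk J)).IsMaximal := by rw [h3]; infer_instance
    have h5 := Ideal.map_comap_of_surjective (Ideal.Quotient.mk J) Ideal.Quotient.mk_surjective I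
    rcases Ideal.map_eq_top_or_isMaximal_of_surjective (Ideal.Quotient.mk J)
      Ideal.Quotient.mk_surjective h4 with h6 | h6
    · exact absurd (h5.symm.trans h6) hI.ne_top
    · rwa [h5] at h6
  have hA : IsArtinianRing (R ⧸ J) := isArtinianRing_iff_isNoetherianRing_krullDimLE_zero.2
    ⟨inferInstance, this⟩
  have ht : Module.IsTorsionBySet R M (J : Set R) := fun m j => hJ j.1 j.2 m
  let : Module (R ⧸ J) M := ht.module
  have : IsScalarTower R (R ⧸ J) M := ht.isScalarTower
  have : Module.Finite (R ⧸ J) M := Module.Finite.of_restrictScalars_finite R _ _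
  have : IsArtinian (R ⧸ J) M := inferInstance
  exact isArtinian_of_surjective_algebraMap (R := R ⧸ J) Ideal.Quotient.mk_surjective

theorem nak_smul {M : Type u} [AddCommGroup M] [Module R M] [Module.Finite R M] {x : R}
    (hx : x ∈ maximalIdeal R) (h : ∀ m : M, ∃ n : M, x • n = m) : Subsingleton M := by
  have : (⊤ : Submodule R M) = ⊥ := by
    apply Submodule.eq_bot_of_le_smul_of_le_jacobson_bot (maximalIdeal R) _
      (IsNoetherian.noetherian _)
    · intro m _
      obtain ⟨n, rfl⟩ := h m
      exact Submodule.smul_mem_smul hx trivial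
    · rw [IsLocalRing.jacobson_eq_maximalIdeal _ bot_ne_top]
  exact (Submodule.subsingleton_iff R).1 (subsingleton_of_bot_eq_top this.symm)

theorem PF_aux {N : Type u} [AddCommGroup N] [Module R N] [Module.Finite R N] {c : ℕ}
    (h : ∀ i, c < i → Subsingleton (XE R (ResidueField R) N i)) (I : Ideal R) :
    ∀ (M : Type u) [AddCommGroup M] [Module R M] [Module.Finite R M],
      (∀ j ∈ I, ∀ m : M, j • m = 0) → ∀ i, c < i → Subsingleton (XE R M N i) := by
  induction I using WellFoundedGT.induction with
  | _ I ih =>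
  intro M _ _ _ hM i hi
  by_cases hm : maximalIdeal R ≤ I
  · refine fl_van (h i hi) (fl_of_ann I hM fun q hq hIq => ?_)
    exact ((IsLocalRing.maximalIdeal.isMaximal R).eq_of_le hq.ne_top (hm.trans hIq)).symm
  obtain ⟨x, hx, hxI⟩ := Set.not_subset.1 hm
  let J := I ⊔ Ideal.span {x}
  have hIJ : I < J := by
    refine lt_of_le_of_ne le_sup_left fun he => hxI ?_
    rw [he]
    exact Submodule.mem_sup_right (Ideal.mem_span_singleton_self x)
  let μ : M →ₗ[R] M := x • LinearMap.id
  have key : ∀ (P : Type u) [AddCommGroup P] [Module R P] [Module.Finite R P],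
      (∀ j ∈ I, ∀ m : P, j • m = 0) → (∀ p : P, x • p = 0) → ∀ i, c < i →
      Subsingleton (XE R P N i) := by
    intro P _ _ _ h1 h2 i hi
    refine ih J hIJ P ?_ i hi
    intro j hj p
    obtain ⟨a, ha, b, hb, rfl⟩ := Submodule.mem_sup.1 hj
    obtain ⟨r, rfl⟩ := Ideal.mem_span_singleton'.1 hb
    rw [add_smul, h1 a ha, mul_smul, h2, smul_zero, add_zero]
  have s1 : Function.Surjective (XE.pre N (LinearMap.range μ).subtype i) := by
    refine XE.surj_of_exact (XE.exc₁ (N := N) (SES.of_submodule (LinearMap.range μ)) i) ?_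
    refine key _ ?_ ?_ _ (by omega)
    · intro j hj q
      obtain ⟨m, rfl⟩ := Submodule.Quotient.mk_surjective _ q
      rw [← Submodule.Quotient.mk_smul, hM j hj, Submodule.Quotient.mk_zero]
    · intro q
      obtain ⟨m, rfl⟩ := Submodule.Quotient.mk_surjective _ q
      rw [← Submodule.Quotient.mk_smul, Submodule.Quotient.mk_eq_zero]
      exact ⟨m, rfl⟩
  have s2 : Function.Surjective (XE.pre N μ.rangeRestrict i) := by
    refine XE.surj_of_exact (XE.exc₂ (N := N) (SES.of_surj μ.surjective_rangeRestrict) i) ?_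
    refine key _ ?_ ?_ _ (by omega)
    · intro j hj q
      exact Subtype.ext (hM j hj _)
    · intro q
      have := q.2
      rw [LinearMap.mem_ker] at this
      have h2 := congrArg Subtype.val this
      exact Subtype.ext h2
  refine nak_smul hx fun y => ?_
  obtain ⟨z, rfl⟩ := s2 y
  obtain ⟨w, rfl⟩ := s1 z
  refine ⟨w, ?_⟩
  rw [← XE.pre_comp, ← XE.pre_smul_id]
  rfl

theorem PF {N : Type u} [AddCommGroup N] [Module R N] [Module.Finite R N] {c : ℕ}
    (h : ∀ i, c < i → Subsingleton (XE R (ResidueField R) N i))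
    (M : Type u) [AddCommGroup M] [Module R M] [Module.Finite R M] (i : ℕ) (hi : c < i) :
    Subsingleton (XE R M N i) :=
  PF_aux h ⊥ M (by rintro j hj m; rw [Submodule.mem_bot] at hj; rw [hj, zero_smul]) i hi

end PF

section RegSeq

open RingTheory.Sequence Pointwise

variable {R : Type u} [CommRing R]

/-- quotient by a sequence -/
abbrev MQ (M : Type u) [AddCommGroup M] [Module R M] (rs : List R) : Type u :=
  M ⧸ (Ideal.ofList rs • ⊤ : Submodule R M)

theorem ses_smul {M : Type u} [AddCommGroup M] [Module R M] {x : R} (hx : IsSMulRegular M x) :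
    SES (x • (LinearMap.id : M →ₗ[R] M)) (x • (⊤ : Submodule R M)).mkQ where
  inj := hx
  ex := by
    intro m
    rw [Submodule.mkQ_apply, Submodule.Quotient.mk_eq_zero, Submodule.mem_smul_pointwise_iff_exists]
    simp
  surj := Submodule.mkQ_surjective _

theorem wr_retract (rs : List R) : ∀ {M M' : Type u} [AddCommGroup M] [Module R M]
    [AddCommGroup M'] [Module R M'] (i : M' →ₗ[R] M) (p : M →ₗ[R] M') (_ : p ∘ₗ i = LinearMap.id)
    (_ : IsWeaklyRegular M rs), IsWeaklyRegular M' rs := by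
  induction rs with
  | nil => intros; exact IsWeaklyRegular.nil R _
  | cons x rs ih =>
    intro M M' _ _ _ _ i p hpi h
    rw [isWeaklyRegular_cons_iff] at h ⊢
    refine ⟨?_, ih (QuotSMulTop.map x i) (QuotSMulTop.map x p) ?_ h.2⟩
    · refine h.1.of_injective i ?_
      exact Function.LeftInverse.injective (g := p) fun m => by
        simpa using LinearMap.congr_fun hpi m
    · rw [← QuotSMulTop.map_comp, hpi, QuotSMulTop.map_id]

theorem wr_van_up (rs : List R) {N : Type u} [AddCommGroup N] [Module R N] :
    ∀ (c : ℕ) (M : Type u) [AddCommGroup M] [Module R M] (_ : IsWeaklyRegular M rs)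
    (_ : ∀ i, c < i → Subsingleton (XE R M N i)), ∀ i, c + rs.length < i →
      Subsingleton (XE R (MQ M rs) N i) := by
  induction rs with
  | nil =>
    intro c M _ _ _ h i hi
    refine XE.van_left (Submodule.quotEquivOfEqBot _ ?_).symm (h i (by simpa using hi))
    simp
  | cons x rs ih =>
    intro c M _ _ hr h i hi
    rw [isWeaklyRegular_cons_iff] at hr
    refine XE.van_left (Submodule.quotOfListConsSMulTopEquivQuotSMulTopInner M x rs).symm ?_
    refine ih (c+1) (QuotSMulTop x M) hr.2 ?_ i (by simp at hi; omega)
    intro j hj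
    obtain ⟨j, rfl⟩ : ∃ k, j = k + 1 := ⟨j - 1, by omega⟩
    exact XE.sub_of_exact (XE.exc₃ (N := N) (ses_smul hr.1) j) (h _ (by omega)) (h _ (by omega))

variable [IsNoetherianRing R] [IsLocalRing R]

theorem wr_van_down (rs : List R) (hrs : ∀ r ∈ rs, r ∈ maximalIdeal R)
    {N : Type u} [AddCommGroup N] [Module R N] [Module.Finite R N] {D : ℕ}
    (H : ∀ (M : Type u) [AddCommGroup M] [Module R M] [Module.Finite R M] (i : ℕ), D < i →
      Subsingleton (XE R M N i)) :
    ∀ (M : Type u) [AddCommGroup M] [Module R M] [Module.Finite R M] (_ : IsWeaklyRegular M rs),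
     ∀ i, D < i + rs.length → Subsingleton (XE R M N i) := by
  induction rs with
  | nil =>
    intro M _ _ _ _ i hi
    exact H M i hi
  | cons x rs ih =>
    intro M _ _ _ hr i hi
    rw [isWeaklyRegular_cons_iff] at hr
    have h1 : Subsingleton (XE R (QuotSMulTop x M) N (i+1)) :=
      ih (fun r hr => hrs r (List.mem_cons_of_mem _ hr)) (QuotSMulTop x M) hr.2 (i+1)
        (by simp at hi; omega)
    refine nak_smul (hrs x List.mem_cons_self) fun y => ?_
    obtain ⟨w, hw⟩ := XE.surj_of_exact (XE.exc₁ (N := N) (ses_smul hr.1) i) h1 y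
    exact ⟨w, by rw [← XE.pre_smul_id]; exact hw⟩

theorem smul_top_lt (M : Type u) [AddCommGroup M] [Module R M] [Module.Finite R M] [Nontrivial M] :
    maximalIdeal R • (⊤ : Submodule R M) < ⊤ := by
  rw [lt_top_iff_ne_top]
  intro h
  have := Submodule.eq_bot_of_le_smul_of_le_jacobson_bot (maximalIdeal R) (⊤ : Submodule R M)
      (IsNoetherian.noetherian _) h.ge (by rw [IsLocalRing.jacobson_eq_maximalIdeal _ bot_ne_top])
  exact bot_ne_top this.symm

theorem supp_residue : Module.support R (ResidueField R) =
    PrimeSpectrum.zeroLocus (maximalIdeal R : Set R) := by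
  have : Module.annihilator R (ResidueField R) = maximalIdeal R := Ideal.annihilator_quotient
  rw [Module.support_eq_zeroLocus, this]

theorem rees_exists {n : ℕ} (M : Type u) [AddCommGroup M] [Module R M] [Module.Finite R M]
    [Nontrivial M] (h : ∀ i < n, Subsingleton (XE R (ResidueField R) M i)) :
    ∃ rs : List R, rs.length = n ∧ (∀ r ∈ rs, r ∈ maximalIdeal R) ∧ IsRegular M rs :=
  ModuleCat.exists_isRegular_of_exists_subsingleton_ext (maximalIdeal R) n (ModuleCat.of R M)
    (smul_top_lt M) (ModuleCat.of R (ResidueField R)) supp_residue h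

theorem rees_van (M : Type u) [AddCommGroup M] [Module R M] [Module.Finite R M]
    [Nontrivial M] (rs : List R) (hrs : ∀ r ∈ rs, r ∈ maximalIdeal R) (h : IsRegular M rs) :
    ∀ i < rs.length, Subsingleton (XE R (ResidueField R) M i) :=
  ModuleCat.subsingleton_ext_of_exists_isRegular (maximalIdeal R)
    (ModuleCat.of R (ResidueField R)) supp_residue.le (ModuleCat.of R M)
    (smul_top_lt M) rs hrs h

theorem prime_of_reg {d : ℕ} (hdim : ringKrullDim R = d) (rs : List R) (hlen : rs.length = d)
    (hr : IsRegular R rs) (q : Ideal R) (hq : q.IsPrime) (hle : Ideal.ofList rs ≤ q) :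
    q = maximalIdeal R := by
  have h1 := ringKrullDim_add_length_eq_ringKrullDim_of_isRegular rs hr
  have h2 : ringKrullDim (R ⧸ Ideal.ofList rs) ≤ (0 : ℕ) := by
    rw [hdim, hlen] at h1
    generalize ringKrullDim (R ⧸ Ideal.ofList rs) = z at h1
    induction z with
    | bot => exact bot_le
    | coe z =>
      induction z with
      | top => exact absurd h1 (by rw [← WithBot.coe_natCast, ← WithBot.coe_add, top_add]; exact_mod_cast ENat.top_ne_natCast d)
      | coe z =>
        have : z + d = d := by exact_mod_cast h1
        have : z = 0 := by omega
        subst this; exact le_rfl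
  have h3 : Ring.KrullDimLE 0 (R ⧸ Ideal.ofList rs) := Ring.krullDimLE_iff.2 h2
  have h4 : (q.map (Ideal.Quotient.mk (Ideal.ofList rs))).IsPrime :=
    Ideal.map_isPrime_of_surjective Ideal.Quotient.mk_surjective (by rwa [Ideal.mk_ker])
  have h5 : (q.map (Ideal.Quotient.mk (Ideal.ofList rs))).IsMaximal := h4.isMaximal'
  have h6 : ((q.map (Ideal.Quotient.mk (Ideal.ofList rs))).comap
     (Ideal.Quotient.mk (Ideal.ofList rs))).IsMaximal :=
    Ideal.comap_isMaximal_of_surjective _ Ideal.Quotient.mk_surjective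
  rw [Ideal.comap_map_of_surjective _ Ideal.Quotient.mk_surjective, ← RingHom.ker_eq_comap_bot,
    Ideal.mk_ker, sup_eq_left.2 hle] at h6
  exact IsLocalRing.eq_maximalIdeal h6

theorem MQ_ann {M : Type u} [AddCommGroup M] [Module R M] (rs : List R) :
    ∀ j ∈ Ideal.ofList rs, ∀ m : MQ M rs, j • m = 0 := by
  intro j hj m
  obtain ⟨m, rfl⟩ := Submodule.Quotient.mk_surjective _ m
  rw [← Submodule.Quotient.mk_smul, Submodule.Quotient.mk_eq_zero]
  exact Submodule.smul_mem_smul hj trivial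

theorem MQ_fl {M : Type u} [AddCommGroup M] [Module R M] [Module.Finite R M]
    {d : ℕ} (hdim : ringKrullDim R = d) (rs : List R) (hlen : rs.length = d)
    (hr : IsRegular R rs) : IsFiniteLength R (MQ M rs) :=
  fl_of_ann (Ideal.ofList rs) (MQ_ann rs) (prime_of_reg hdim rs hlen hr)

/-- injective-dimension bound -/
theorem inj_bound {d : ℕ} (hdim : ringKrullDim R = d) (rs : List R) (hlen : rs.length = d)
    (hr : IsRegular R rs) {N : Type u} [AddCommGroup N] [Module R N] (D : ℕ) :
    (∀ i, d + D < i → Subsingleton (XE R (ResidueField R) N i)) →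
    ∀ i, d < i → Subsingleton (XE R (ResidueField R) N i) := by
  induction D with
  | zero => intro h; exact h
  | succ D ih =>
    intro h
    refine ih fun i hi => ?_
    by_cases hi2 : d + (D+1) < i
    · exact h i hi2
    have hfl : IsFiniteLength R (MQ R rs) := MQ_fl hdim rs hlen hr
    have := (isFiniteLength_iff_isNoetherian_isArtinian.1 hfl).2
    have hnt : Nontrivial (MQ R rs) := by
      rw [Submodule.Quotient.nontrivial_iff]
      exact hr.top_ne_smul.symm
    obtain ⟨P, hP⟩ := IsAtomic.exists_atom (Submodule R (MQ R rs))
    have hs : IsSimpleModule R P := isSimpleModule_iff_isAtom.2 hP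
    obtain ⟨e⟩ := simple_equiv_residue (R := R) P
    refine XE.van_left e ?_
    refine XE.sub_of_exact (XE.exc₁ (N := N) (SES.of_submodule P) i) ?_ ?_
    · refine wr_van_up rs 0 R hr.toIsWeaklyRegular ?_ i (by omega)
      intro j hj
      obtain ⟨j, rfl⟩ : ∃ k, j = k + 1 := ⟨j - 1, by omega⟩
      infer_instance
    · exact fl_van (h _ (by omega)) (fl_quotient hfl P)

end RegSeq

section EndOmega

open RingTheory.Sequence Pointwise

variable {R : Type u} [CommRing R]

theorem rees_low (rs : List R) {L : Type u} [AddCommGroup L] [Module R L]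
    (hL : ∀ r ∈ rs, ∀ l : L, r • l = 0) : ∀ (N : Type u) [AddCommGroup N] [Module R N]
    (_ : IsWeaklyRegular N rs) (i : ℕ), i < rs.length → Subsingleton (XE R L N i) := by
  induction rs with
  | nil => intro N _ _ _ i hi; simp at hi
  | cons x rs ih =>
    intro N _ _ hr i hi
    rw [isWeaklyRegular_cons_iff] at hr
    have hx : ∀ y : XE R L N i, x • y = 0 := fun y =>
      XE.smul_eq_zero_of_ann_left (hL x List.mem_cons_self) y
    cases i with
    | zero =>
      refine XE.zeroEquiv.toEquiv.subsingleton_congr.2 (subsingleton_of_forall_eq 0 fun φ => ?_)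
      ext l
      apply hr.1
      simp only [LinearMap.zero_apply, smul_zero]
      rw [← map_smul, hL x List.mem_cons_self, map_zero]
    | succ i =>
      have h1 : Subsingleton (XE R L (QuotSMulTop x N) i) :=
        ih (fun r h => hL r (List.mem_cons_of_mem _ h)) _ hr.2 i (by simpa using hi)
      have h2 := XE.inj_of_exact (XE.exv₁ (M := L) (ses_smul hr.1) i) h1
      refine subsingleton_of_forall_eq 0 fun y => h2 ?_
      rw [XE.post_smul_id, hx, map_zero]

theorem rees_iso (rs : List R) {L : Type u} [AddCommGroup L] [Module R L]
    (hL : ∀ r ∈ rs, ∀ l : L, r • l = 0) : ∀ (N : Type u) [AddCommGroup N] [Module R N]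
    (_ : IsWeaklyRegular N rs), Nonempty (XE R L N rs.length ≃ₗ[R] (L →ₗ[R] MQ N rs)) := by
  induction rs with
  | nil =>
    intro N _ _ _
    have e : N ≃ₗ[R] MQ N ([] : List R) := (Submodule.quotEquivOfEqBot _ (by simp)).symm
    exact ⟨XE.zeroEquiv.trans (LinearEquiv.congrRight e)⟩
  | cons x rs ih =>
    intro N _ _ hr0
    have hr := hr0
    rw [isWeaklyRegular_cons_iff] at hr
    obtain ⟨e⟩ := ih (fun r h => hL r (List.mem_cons_of_mem _ h)) (QuotSMulTop x N) hr.2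
    have b : Function.Bijective (XE.dv L (ses_smul hr.1) rs.length) := by
      constructor
      · exact XE.inj_of_exact (XE.exv₃ (M := L) (ses_smul hr.1) rs.length)
          (rees_low (x :: rs) hL N hr0 _ (by simp))
      · intro y
        refine ((XE.exv₁ (M := L) (ses_smul hr.1) rs.length) y).1 ?_
        rw [XE.post_smul_id]
        exact XE.smul_eq_zero_of_ann_left (hL x List.mem_cons_self) y
    exact ⟨(LinearEquiv.ofBijective _ b).symm.trans (e.trans (LinearEquiv.congrRight
      (Submodule.quotOfListConsSMulTopEquivQuotSMulTopInner N x rs).symm))⟩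

/-- homs from a cyclic module -/
theorem hom_cyclic (J : Ideal R) {E : Type u} [AddCommGroup E] [Module R E]
    (hE : ∀ j ∈ J, ∀ e : E, j • e = 0) :
    Nonempty (((R ⧸ (J • ⊤ : Submodule R R)) →ₗ[R] E) ≃ₗ[R] E) := by
  let ev : ((R ⧸ (J • ⊤ : Submodule R R)) →ₗ[R] E) →ₗ[R] E :=
    LinearMap.applyₗ (Submodule.Quotient.mk 1)
  refine ⟨LinearEquiv.ofBijective ev ⟨?_, ?_⟩⟩
  · rw [injective_iff_map_eq_zero]
    intro φ hφ
    refine Submodule.linearMap_qext _ (LinearMap.ext_ring ?_)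
    exact hφ
  · intro e
    refine ⟨(J • ⊤ : Submodule R R).liftQ (LinearMap.toSpanSingleton R E e) ?_, ?_⟩
    · rw [Submodule.smul_le]
      intro j hj n _
      rw [LinearMap.mem_ker, map_smul, LinearMap.toSpanSingleton_apply]
      exact hE j hj _
    · change (1 : R) • e = e
      exact one_smul R e

variable [IsNoetherianRing R] [IsLocalRing R]

theorem lift_step {W P N : Type u} [AddCommGroup W] [Module R W] [AddCommGroup P] [Module R P]
    [AddCommGroup N] [Module R N] [Module.Finite R W] [Module.Finite R P] [Module.Finite R N]
    (θ : P →ₗ[R] (W →ₗ[R] N)) {x : R} (hx : x ∈ maximalIdeal R) (hr : IsSMulRegular N x)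
    (θ' : QuotSMulTop x P →ₗ[R] (W →ₗ[R] QuotSMulTop x N))
    (hθ : ∀ p w, θ' (Submodule.Quotient.mk p) w = Submodule.Quotient.mk (θ p w))
    (hb : Function.Bijective θ') : Function.Bijective θ := by
  have hj : maximalIdeal R ≤ (⊥ : Ideal R).jacobson := by
    rw [IsLocalRing.jacobson_eq_maximalIdeal _ bot_ne_top]
  constructor
  · rw [← LinearMap.ker_eq_bot]
    apply Submodule.eq_bot_of_le_smul_of_le_jacobson_bot (maximalIdeal R) _
      (IsNoetherian.noetherian _) _ hj
    intro p hp
    have h1 : θ' (Submodule.Quotient.mk p) = 0 := by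
      ext w
      rw [hθ, LinearMap.mem_ker.1 hp]; rfl
    have h2 : (Submodule.Quotient.mk p : QuotSMulTop x P) = 0 := hb.1 (by rw [h1, map_zero])
    rw [Submodule.Quotient.mk_eq_zero, Submodule.mem_smul_pointwise_iff_exists] at h2
    obtain ⟨p', -, rfl⟩ := h2
    refine Submodule.smul_mem_smul hx ?_
    rw [LinearMap.mem_ker, map_smul] at hp
    rw [LinearMap.mem_ker]
    ext w
    apply hr
    have := LinearMap.congr_fun hp w
    simpa using this
  · rw [← LinearMap.range_eq_top, eq_top_iff]
    apply Submodule.le_of_le_smul_of_le_jacobson_bot (I := maximalIdeal R)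
      (IsNoetherian.noetherian _) hj
    intro φ _
    obtain ⟨p', hp'⟩ := hb.2 ((x • (⊤ : Submodule R N)).mkQ ∘ₗ φ)
    obtain ⟨p, rfl⟩ := Submodule.Quotient.mk_surjective _ p'
    have h1 : ∀ w, ∃ n : N, x • n = φ w - θ p w := by
      intro w
      have h2 := LinearMap.congr_fun hp' w
      rw [hθ] at h2
      have h3 : (Submodule.Quotient.mk (φ w - θ p w) : QuotSMulTop x N) = 0 := by
        rw [Submodule.Quotient.mk_sub, h2, sub_eq_zero]; rfl
      rw [Submodule.Quotient.mk_eq_zero, Submodule.mem_smul_pointwise_iff_exists] at h3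
      obtain ⟨n, -, hn⟩ := h3
      exact ⟨n, hn⟩
    choose ψ hψ using h1
    let ψ' : W →ₗ[R] N :=
      { toFun := ψ
        map_add' := by
          intro a b
          apply hr
          simp only [smul_add, hψ, map_add]
          abel
        map_smul' := by
          intro c a
          apply hr
          simp only [RingHom.id_apply]
          rw [smul_comm x c, hψ, hψ, map_smul, map_smul, smul_sub] }
    have h4 : φ = θ p + x • ψ' := by
      ext w
      have : x • ψ' w = φ w - θ p w := hψ w
      simp [this]
    rw [h4]
    exact Submodule.add_mem_sup ⟨p, rfl⟩ (Submodule.smul_mem_smul hx trivial)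

theorem lift_list (rs : List R) (hrs : ∀ r ∈ rs, r ∈ maximalIdeal R)
    {W : Type u} [AddCommGroup W] [Module R W] [Module.Finite R W] :
    ∀ (P N : Type u) [AddCommGroup P] [Module R P]
    [AddCommGroup N] [Module R N] [Module.Finite R P] [Module.Finite R N]
    (θ : P →ₗ[R] (W →ₗ[R] N)) (_ : IsWeaklyRegular N rs)
    (_ : ∀ φ : W →ₗ[R] MQ N rs, ∃ p, ∀ w, φ w = Submodule.Quotient.mk (θ p w))
    (_ : ∀ p, (∀ w, (Submodule.Quotient.mk (θ p w) : MQ N rs) = 0) →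
      (Submodule.Quotient.mk p : MQ P rs) = 0), Function.Bijective θ := by
  induction rs with
  | nil =>
    intro P N _ _ _ _ _ _ θ _ hs hi
    have e0 : ∀ (M : Type u) [AddCommGroup M] [Module R M],
      (Ideal.ofList ([] : List R) • ⊤ : Submodule R M) = ⊥ := by intros; simp
    constructor
    · rw [injective_iff_map_eq_zero]
      intro p hp
      have := hi p fun w => by rw [hp]; rfl
      rwa [Submodule.Quotient.mk_eq_zero, e0, Submodule.mem_bot] at this
    · intro φ
      obtain ⟨p, hp⟩ := hs ((Ideal.ofList ([] : List R) • ⊤ : Submodule R N).mkQ ∘ₗ φ)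
      refine ⟨p, LinearMap.ext fun w => ?_⟩
      have := (Submodule.Quotient.eq _).1 (hp w)
      rw [e0, Submodule.mem_bot, sub_eq_zero] at this
      exact this.symm
  | cons x rs ih =>
    intro P N _ _ _ _ _ _ θ hr hs hi
    rw [isWeaklyRegular_cons_iff] at hr
    let θ' : QuotSMulTop x P →ₗ[R] (W →ₗ[R] QuotSMulTop x N) :=
      (x • (⊤ : Submodule R P)).liftQ
        ((LinearMap.llcomp R W N _ (x • (⊤ : Submodule R N)).mkQ) ∘ₗ θ) (by
          intro p hp
          obtain ⟨p, -, rfl⟩ := (Submodule.mem_smul_pointwise_iff_exists _ _ _).1 hp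
          rw [LinearMap.mem_ker]
          ext w
          simp only [map_smul]
          simp only [LinearMap.smul_apply, LinearMap.comp_apply, LinearMap.llcomp_apply,
            LinearMap.zero_apply]
          rw [← map_smul, Submodule.mkQ_apply, Submodule.Quotient.mk_eq_zero]
          exact Submodule.smul_mem_pointwise_smul _ _ _ trivial)
    have hθ : ∀ p w, θ' (Submodule.Quotient.mk p) w = Submodule.Quotient.mk (θ p w) := by
      intro p w; rfl
    refine lift_step θ (hrs x List.mem_cons_self) hr.1 θ' hθ ?_
    refine ih (fun r h => hrs r (List.mem_cons_of_mem _ h)) _ _ θ' hr.2 ?_ ?_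
    · intro φ
      obtain ⟨p, hp⟩ := hs
        ((Submodule.quotOfListConsSMulTopEquivQuotSMulTopInner N x rs).symm.toLinearMap ∘ₗ φ)
      refine ⟨Submodule.Quotient.mk p, fun w => ?_⟩
      have := hp w
      rw [LinearMap.comp_apply, LinearEquiv.coe_coe, LinearEquiv.symm_apply_eq] at this
      rw [this]
      rfl
    · intro p hp
      obtain ⟨p, rfl⟩ := Submodule.Quotient.mk_surjective _ p
      have := hi p fun w => by
        have h1 := hp w
        rw [hθ] at h1
        apply (Submodule.quotOfListConsSMulTopEquivQuotSMulTopInner N x rs).injective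
        rw [map_zero]
        exact h1
      have h2 := congrArg (Submodule.quotOfListConsSMulTopEquivQuotSMulTopInner P x rs) this
      rw [map_zero] at h2
      exact h2

theorem end_omega {e : ℕ} (hdim : ringKrullDim R = (e + 1 : ℕ)) {W : Type u} [AddCommGroup W]
    [Module R W] [Module.Finite R W] (rs : List R) (hlen : rs.length = e + 1)
    (hrs : ∀ r ∈ rs, r ∈ maximalIdeal R) (hR : IsRegular R rs) (hW : IsWeaklyRegular W rs)
    (h0 : Subsingleton (XE R (ResidueField R) W e))
    (h1 : Nonempty (XE R (ResidueField R) W (e+1) ≃ₗ[R] ResidueField R))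
    (h2 : Subsingleton (XE R (ResidueField R) W (e+2))) :
    Function.Bijective (LinearMap.lsmul R W : R →ₗ[R] (W →ₗ[R] W)) := by
  have h1' : ¬ Subsingleton (XE R (ResidueField R) W (e+1)) := by
    obtain ⟨k⟩ := h1
    rw [k.toEquiv.subsingleton_congr]
    exact not_subsingleton _
  have flA : IsFiniteLength R (MQ R rs) := MQ_fl hdim rs hlen hR
  have flE : IsFiniteLength R (MQ W rs) := MQ_fl hdim rs hlen hR
  have mem : ∀ r ∈ rs, r ∈ Ideal.ofList rs := fun r hr => Ideal.subset_span hr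
  obtain ⟨iA⟩ := rees_iso rs (L := MQ R rs) (fun r hr => MQ_ann rs r (mem r hr)) W hW
  obtain ⟨iE⟩ := rees_iso rs (L := MQ W rs) (fun r hr => MQ_ann rs r (mem r hr)) W hW
  rw [hlen] at iA iE
  obtain ⟨c⟩ := hom_cyclic (Ideal.ofList rs) (E := MQ W rs) (MQ_ann rs)
  have inj : ∀ r : R, (∀ m : MQ W rs, r • m = 0) → (Submodule.Quotient.mk r : MQ R rs) = 0 := by
    intro r hr
    have := fl_ann h0 h1' h2 flA (a := r) (fun y => by
      apply (iA.trans c).injective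
      rw [map_smul, map_zero, hr]) (Submodule.Quotient.mk 1)
    rw [← Submodule.Quotient.mk_smul] at this
    simpa using this
  let θE : R →ₗ[R] (MQ W rs →ₗ[R] MQ W rs) := LinearMap.lsmul R _
  have hker : LinearMap.ker θE = (Ideal.ofList rs • ⊤ : Submodule R R) := by
    apply le_antisymm
    · intro r hr
      rw [← Submodule.Quotient.mk_eq_zero]
      exact inj r fun m => LinearMap.congr_fun hr m
    · rw [Submodule.smul_le]
      intro j hj n _
      rw [LinearMap.mem_ker]
      exact LinearMap.ext fun m => MQ_ann (M := W) rs (j * n) (Ideal.mul_mem_right n _ hj) m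
  have hlenE : Module.length R (MQ W rs →ₗ[R] MQ W rs) = Module.length R (MQ R rs) := by
    rw [← iE.length_eq, fl_length h0 h1 h2 flE, ← (iA.trans c).length_eq, fl_length h0 h1 h2 flA]
  have hrange : LinearMap.range θE = ⊤ := by
    by_contra hne
    have hfl : IsFiniteLength R (MQ W rs →ₗ[R] MQ W rs) := by
      rw [← Module.length_ne_top_iff, hlenE, Module.length_ne_top_iff]; exact flA
    obtain ⟨_, _⟩ := isFiniteLength_iff_isNoetherian_isArtinian.1 hfl
    have := Submodule.length_lt hne
    rw [hlenE, ← θE.quotKerEquivRange.length_eq,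
      (Submodule.quotEquivOfEq _ _ hker).length_eq] at this
    exact lt_irrefl _ this
  refine lift_list rs hrs R W _ hW ?_ ?_
  · intro φ
    let φ' : MQ W rs →ₗ[R] MQ W rs := (Ideal.ofList rs • ⊤ : Submodule R W).liftQ φ (by
      rw [Submodule.smul_le]
      intro j hj n _
      rw [LinearMap.mem_ker, map_smul, MQ_ann rs j hj])
    obtain ⟨r, hr⟩ := LinearMap.range_eq_top.1 hrange φ'
    refine ⟨r, fun w => ?_⟩
    have := LinearMap.congr_fun hr (Submodule.Quotient.mk w)
    exact this.symm
  · intro r hr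
    refine inj r fun m => ?_
    obtain ⟨w, rfl⟩ := Submodule.Quotient.mk_surjective _ m
    exact hr w

end EndOmega

section Loc

variable {R : Type u} [CommRing R] (S : Submonoid R)

theorem SES.loc {A B C : Type u} [AddCommGroup A] [Module R A] [AddCommGroup B] [Module R B]
    [AddCommGroup C] [Module R C] {f : A →ₗ[R] B} {g : B →ₗ[R] C} (h : SES f g) :
    SES (R := Localization S) (LocalizedModule.map S f) (LocalizedModule.map S g) where
  inj := IsLocalizedModule.map_injective S (LocalizedModule.mkLinearMap S A)
    (LocalizedModule.mkLinearMap S B) f h.inj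
  ex := LocalizedModule.map_exact S f g h.ex
  surj := IsLocalizedModule.map_surjective S (LocalizedModule.mkLinearMap S B)
    (LocalizedModule.mkLinearMap S C) g h.surj

instance loc_finite {M : Type u} [AddCommGroup M] [Module R M] [Module.Finite R M] :
    Module.Finite (Localization S) (LocalizedModule S M) :=
  Module.Finite.of_isLocalizedModule S (LocalizedModule.mkLinearMap S M)

theorem loc_free {M : Type u} [AddCommGroup M] [Module R M] [Module.Free R M] :
    Module.Free (Localization S) (LocalizedModule S M) :=
  Module.free_of_isLocalizedModule S (LocalizedModule.mkLinearMap S M)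

/-- localised maps come from global ones, up to a denominator -/
theorem loc_hom {M N : Type u} [AddCommGroup M] [Module R M] [AddCommGroup N] [Module R N]
    [Module.FinitePresentation R M]
    (ψ : LocalizedModule S M →ₗ[Localization S] LocalizedModule S N) :
    ∃ (φ : M →ₗ[R] N) (s : S), LocalizedModule.map S φ = (s : R) • ψ := by
  obtain ⟨φ, s, h⟩ := Module.FinitePresentation.exists_lift_of_isLocalizedModule S
    (LocalizedModule.mkLinearMap S N) (ψ.restrictScalars R ∘ₗ LocalizedModule.mkLinearMap S M)
  refine ⟨φ, s, ?_⟩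
  have key : (LocalizedModule.map S φ).restrictScalars R = ((s : R) • ψ).restrictScalars R := by
    apply IsLocalizedModule.linearMap_ext S (LocalizedModule.mkLinearMap S M)
      (LocalizedModule.mkLinearMap S N)
    ext m
    have := LinearMap.congr_fun h m
    simp only [LinearMap.comp_apply, LinearMap.restrictScalars_apply,
      LocalizedModule.mkLinearMap_apply, LinearMap.smul_apply, LocalizedModule.map_mk] at this ⊢
    exact this
  ext m
  exact LinearMap.congr_fun key m

theorem loc_unit {M : Type u} [AddCommGroup M] [Module R M] (s : S) (m : LocalizedModule S M) :
    (Localization.mk 1 s : Localization S) • ((s : R) • m) = m := by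
  rw [← algebraMap_smul (Localization S) (s : R) m, smul_smul, ← Localization.mk_one_eq_algebraMap,
    Localization.mk_mul]
  simp [Localization.mk_self]

variable [IsNoetherianRing R]

theorem loc_ext_van (i : ℕ) : ∀ (M N : Type u) [AddCommGroup M] [Module R M] [AddCommGroup N]
    [Module R N] [Module.Finite R M] [Module.Finite R N] (_ : Subsingleton (XE R M N (i+1))),
    Subsingleton (XE (Localization S) (LocalizedModule S M) (LocalizedModule S N) (i+1)) := by
  induction i with
  | zero =>
    intro M N _ _ _ _ _ _ h
    obtain ⟨n, π, hπ⟩ := Module.Finite.exists_fin' R M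
    -- cover
    let F : Type u := Fin n → R
    let π' : F →ₗ[R] M := π
    have hs : SES (LinearMap.ker π').subtype π' := SES.of_surj hπ
    have hl := hs.loc S
    have hF : Module.Free (Localization S) (LocalizedModule S F) := loc_free S
    have : Module.FinitePresentation R (LinearMap.ker π') :=
      Module.finitePresentation_of_finite R _
    refine subsingleton_of_forall_eq 0 fun y => ?_
    have hz : Subsingleton (XE (Localization S) (LocalizedModule S F) (LocalizedModule S N) 1) :=
      XE.projective_van 0
    obtain ⟨z, rfl⟩ := XE.surj_of_exact (XE.exc₃ (N := LocalizedModule S N) hl 0) hz y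
    rw [(XE.exc₁ hl 0) z]
    obtain ⟨ψ, rfl⟩ := XE.zeroEquiv.symm.surjective z
    obtain ⟨φ, s, hφ⟩ := loc_hom S ψ
    obtain ⟨y, hy⟩ := XE.surj_of_exact (XE.exc₁ (N := N) hs 0) h (XE.zeroEquiv.symm φ)
    obtain ⟨χ, rfl⟩ := XE.zeroEquiv.symm.surjective y
    rw [XE.pre_zero] at hy
    have hy2 : χ ∘ₗ (LinearMap.ker π').subtype = φ := XE.zeroEquiv.symm.injective hy
    refine ⟨XE.zeroEquiv.symm ((Localization.mk 1 s : Localization S) • (LocalizedModule.map S χ)), ?_⟩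
    rw [XE.pre_zero]
    congr 1
    ext m
    have e1 : (s : R) • ψ m = LocalizedModule.map S φ m := by rw [hφ]; rfl
    rw [← loc_unit S s (ψ m), e1]
    change (Localization.mk 1 s : Localization S) •
      (LocalizedModule.map S χ (LocalizedModule.map S (LinearMap.ker π').subtype m)) = _
    congr 1
    induction m using LocalizedModule.induction_on with
    | h m t =>
      rw [LocalizedModule.map_mk, LocalizedModule.map_mk, LocalizedModule.map_mk, ← hy2]
      rfl
  | succ i ih =>
    intro M N _ _ _ _ _ _ h
    obtain ⟨n, π, hπ⟩ := Module.Finite.exists_fin' R M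
    let F : Type u := Fin n → R
    let π' : F →ₗ[R] M := π
    have hs : SES (LinearMap.ker π').subtype π' := SES.of_surj hπ
    have hl := hs.loc S
    have hF : Module.Free (Localization S) (LocalizedModule S F) := loc_free S
    have h1 : Subsingleton (XE R (LinearMap.ker π') N (i+1)) :=
      XE.sub_of_exact (XE.exc₁ (N := N) hs (i+1)) (XE.projective_van i) h
    have h2 := ih (LinearMap.ker π') N h1
    exact XE.sub_of_exact (XE.exc₃ (N := LocalizedModule S N) hl (i+1)) h2 (XE.projective_van (i+1))

theorem loc_end {W : Type u} [AddCommGroup W] [Module R W] [Module.Finite R W]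
    (h : ∀ φ : W →ₗ[R] W, ∃ r : R, ∀ w, φ w = r • w)
    (ψ : LocalizedModule S W →ₗ[Localization S] LocalizedModule S W) :
    ∃ b : Localization S, ∀ w, ψ w = b • w := by
  have : Module.FinitePresentation R W := Module.finitePresentation_of_finite R _
  obtain ⟨φ, s, hφ⟩ := loc_hom S ψ
  obtain ⟨r, hr⟩ := h φ
  refine ⟨Localization.mk 1 s * algebraMap R _ r, fun w => ?_⟩
  have e1 : (s : R) • ψ w = LocalizedModule.map S φ w := by rw [hφ]; rfl
  rw [← loc_unit S s (ψ w), e1, mul_smul, algebraMap_smul]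
  congr 1
  induction w using LocalizedModule.induction_on with
  | h m t => rw [LocalizedModule.map_mk, hr, LocalizedModule.smul'_mk]

/-- spreading out a rank one decomposition -/
theorem loc_spread {W : Type u} [AddCommGroup W] [Module R W] [Module.Finite R W]
    (u' : LocalizedModule S W) (f' : LocalizedModule S W →ₗ[Localization S] Localization S)
    (h : ∀ w, w = f' w • u') : ∃ s ∈ S, ∃ (u : W) (f : W →ₗ[R] R), ∀ w, s • w = f w • u := by
  have : Module.FinitePresentation R W := Module.finitePresentation_of_finite R _
  obtain ⟨f, s, hf⟩ := Module.FinitePresentation.exists_lift_of_isLocalizedModule S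
    (Algebra.linearMap R (Localization S))
    (f'.restrictScalars R ∘ₗ LocalizedModule.mkLinearMap S W)
  induction u' using LocalizedModule.induction_on with
  | h u t =>
  obtain ⟨c, hc⟩ := Module.Finite.exists_smul_of_comp_eq_of_isLocalizedModule S
    (LocalizedModule.mkLinearMap S W) (((s : R) * (t : R)) • LinearMap.id)
    (LinearMap.toSpanSingleton R W u ∘ₗ f) (by
      ext w
      have h1 := LinearMap.congr_fun hf w
      simp only [LinearMap.comp_apply, LinearMap.smul_apply, LinearMap.id_apply, map_smul,
        LinearMap.toSpanSingleton_apply, LinearMap.restrictScalars_apply,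
        Algebra.linearMap_apply] at h1 ⊢
      have h2 := h (LocalizedModule.mkLinearMap S W w)
      have h3 : (t : R) • LocalizedModule.mk u t = LocalizedModule.mkLinearMap S W u := by
        rw [LocalizedModule.mkLinearMap_apply]
        rw [LocalizedModule.smul'_mk]
        exact LocalizedModule.mk_cancel t u
      rw [← h3, ← algebraMap_smul (Localization S) (f w), h1]
      conv_lhs => rw [h2]
      rw [mul_smul, smul_comm (t : R)]
      exact (smul_assoc (s : R) _ _).symm)
  refine ⟨c * (s * t), S.mul_mem c.2 (S.mul_mem s.2 t.2), u, (c : R) • f, fun w => ?_⟩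
  have h5 := LinearMap.congr_fun hc w
  rw [mul_smul]
  simpa [mul_smul, Submonoid.smul_def] using h5

end Loc


section CovPF

variable {R : Type u} [CommRing R]

theorem proj_of_ext1 {M F : Type u} [AddCommGroup M] [Module R M] [AddCommGroup F] [Module R F]
    [Module.Projective R F] {π : F →ₗ[R] M} (hπ : Function.Surjective π)
    (h : Subsingleton (XE R M (LinearMap.ker π) 1)) : Module.Projective R M := by
  obtain ⟨y, hy⟩ := XE.surj_of_exact (XE.exv₃ (M := M) (SES.of_surj hπ) 0) h
    (XE.zeroEquiv.symm LinearMap.id)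
  obtain ⟨χ, rfl⟩ := XE.zeroEquiv.symm.surjective y
  rw [XE.post_zero] at hy
  exact Module.Projective.of_split χ π (XE.zeroEquiv.symm.injective hy)

theorem pi_van {M N : Type u} [AddCommGroup M] [Module R M] [AddCommGroup N] [Module R N] {i : ℕ}
    (h : Subsingleton (XE R M N i)) (n : ℕ) : Subsingleton (XE R M (Fin n → N) i) := by
  induction n with
  | zero =>
    refine subsingleton_of_forall_eq 0 fun x => ?_
    rw [← XE.post_id i x]
    have : (LinearMap.id : (Fin 0 → N) →ₗ[R] (Fin 0 → N)) = (0 : R) • LinearMap.id :=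
      LinearMap.ext fun _ => Subsingleton.elim _ _
    rw [this, XE.post_smul_id, zero_smul]
  | succ n ih =>
    have hs : SES (LinearMap.single R (fun _ : Fin (n+1) => N) 0)
        (LinearMap.funLeft R N (Fin.succ : Fin n → Fin (n+1))) := by
      refine ⟨Pi.single_injective (M := fun _ : Fin (n+1) => N) 0, fun f => ⟨fun hf => ⟨f 0, ?_⟩, ?_⟩, fun f => ⟨Fin.cons 0 f, ?_⟩⟩
      · ext j
        refine Fin.cases ?_ (fun j => ?_) j
        · simp
        · have := congrFun hf j
          simp [LinearMap.funLeft_apply] at this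
          simp [this]
      · rintro ⟨x, rfl⟩
        ext j
        simp [LinearMap.funLeft_apply]
      · ext j
        simp [LinearMap.funLeft_apply]
    exact XE.sub_of_exact (XE.exv₂ (M := M) hs i) h ih

variable [IsLocalRing R]

theorem fl_van_cov {N : Type u} [AddCommGroup N] [Module R N] {i : ℕ}
    (h : Subsingleton (XE R N (ResidueField R) i)) {L : Type u} [AddCommGroup L] [Module R L]
    (hL : IsFiniteLength R L) : Subsingleton (XE R N L i) := by
  induction hL with
  | @of_subsingleton M _ _ _ =>
    refine subsingleton_of_forall_eq 0 fun x => ?_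
    rw [← XE.post_id i x]
    have : (LinearMap.id : M →ₗ[R] M) = (0 : R) • LinearMap.id :=
      LinearMap.ext fun _ => Subsingleton.elim _ _
    rw [this, XE.post_smul_id, zero_smul]
  | @of_simple_quotient M _ _ P _ hP ih =>
    obtain ⟨e⟩ := simple_equiv_residue (R := R) (M ⧸ P)
    exact XE.sub_of_exact (XE.exv₂ (M := N) (SES.of_submodule P) i) ih (XE.van_right e.symm h)

variable [IsNoetherianRing R]

theorem cov_PF_aux {N : Type u} [AddCommGroup N] [Module R N] [Module.Finite R N] {c : ℕ}
    (h : ∀ i, c < i → Subsingleton (XE R N (ResidueField R) i)) (I : Ideal R) :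
    ∀ (M : Type u) [AddCommGroup M] [Module R M] [Module.Finite R M],
      (∀ j ∈ I, ∀ m : M, j • m = 0) → ∀ i, c < i → Subsingleton (XE R N M i) := by
  induction I using WellFoundedGT.induction with
  | _ I ih =>
  intro M _ _ _ hM i hi
  by_cases hm : maximalIdeal R ≤ I
  · refine fl_van_cov (h i hi) (fl_of_ann I hM fun q hq hIq => ?_)
    exact ((IsLocalRing.maximalIdeal.isMaximal R).eq_of_le hq.ne_top (hm.trans hIq)).symm
  obtain ⟨x, hx, hxI⟩ := Set.not_subset.1 hm
  let J := I ⊔ Ideal.span {x}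
  have hIJ : I < J := by
    refine lt_of_le_of_ne le_sup_left fun he => hxI ?_
    rw [he]
    exact Submodule.mem_sup_right (Ideal.mem_span_singleton_self x)
  let μ : M →ₗ[R] M := x • LinearMap.id
  have key : ∀ (P : Type u) [AddCommGroup P] [Module R P] [Module.Finite R P],
      (∀ j ∈ I, ∀ m : P, j • m = 0) → (∀ p : P, x • p = 0) → ∀ i, c < i →
      Subsingleton (XE R N P i) := by
    intro P _ _ _ h1 h2 i hi
    refine ih J hIJ P ?_ i hi
    intro j hj p
    obtain ⟨a, ha, b, hb, rfl⟩ := Submodule.mem_sup.1 hj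
    obtain ⟨r, rfl⟩ := Ideal.mem_span_singleton'.1 hb
    rw [add_smul, h1 a ha, mul_smul, h2, smul_zero, add_zero]
  have s1 : Function.Surjective (XE.post N (LinearMap.range μ).subtype i) := by
    refine XE.surj_of_exact (XE.exv₂ (M := N) (SES.of_submodule (LinearMap.range μ)) i) ?_
    refine key _ ?_ ?_ _ (by omega)
    · intro j hj q
      obtain ⟨m, rfl⟩ := Submodule.Quotient.mk_surjective _ q
      rw [← Submodule.Quotient.mk_smul, hM j hj, Submodule.Quotient.mk_zero]
    · intro q
      obtain ⟨m, rfl⟩ := Submodule.Quotient.mk_surjective _ q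
      rw [← Submodule.Quotient.mk_smul, Submodule.Quotient.mk_eq_zero]
      exact ⟨m, rfl⟩
  have s2 : Function.Surjective (XE.post N μ.rangeRestrict i) := by
    refine XE.surj_of_exact (XE.exv₃ (M := N) (SES.of_surj μ.surjective_rangeRestrict) i) ?_
    refine key _ ?_ ?_ _ (by omega)
    · intro j hj q
      exact Subtype.ext (hM j hj _)
    · intro q
      have := q.2
      rw [LinearMap.mem_ker] at this
      have h2 := congrArg Subtype.val this
      exact Subtype.ext h2
  refine nak_smul hx fun y => ?_
  obtain ⟨z, rfl⟩ := s1 y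
  obtain ⟨w, rfl⟩ := s2 z
  refine ⟨w, ?_⟩
  rw [← XE.post_comp, ← XE.post_smul_id]
  rfl

theorem cov_PF {N : Type u} [AddCommGroup N] [Module R N] [Module.Finite R N] {c : ℕ}
    (h : ∀ i, c < i → Subsingleton (XE R N (ResidueField R) i))
    (M : Type u) [AddCommGroup M] [Module R M] [Module.Finite R M] (i : ℕ) (hi : c < i) :
    Subsingleton (XE R N M i) :=
  cov_PF_aux h ⊥ M (by rintro j hj m; rw [Submodule.mem_bot] at hj; rw [hj, zero_smul]) i hi

variable (R) in
/-- eventually vanishing Ext from the residue field -/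
def EvVan (N : Type u) [AddCommGroup N] [Module R N] : Prop :=
  ∃ D, ∀ i, D < i → Subsingleton (XE R (ResidueField R) N i)

theorem EvVan.ker {W F : Type u} [AddCommGroup W] [Module R W] [AddCommGroup F] [Module R F]
    (hW : EvVan R W) (hF : EvVan R F) {π : F →ₗ[R] W} (hπ : Function.Surjective π) :
    EvVan R (LinearMap.ker π) := by
  obtain ⟨D, hD⟩ := hW
  obtain ⟨E, hE⟩ := hF
  refine ⟨D + E + 1, fun i hi => ?_⟩
  obtain ⟨j, rfl⟩ : ∃ j, i = j + 1 := ⟨i - 1, by omega⟩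
  exact XE.sub_of_exact (XE.exv₁ (M := ResidueField R) (SES.of_surj hπ) j) (hD j (by omega))
    (hE _ (by omega))

theorem syz_exists (hR : EvVan R R) (n : ℕ) : ∀ (W : Type u) [AddCommGroup W] [Module R W]
    [Module.Finite R W] (_ : EvVan R W), ∃ (T : Type u) (_ : AddCommGroup T) (_ : Module R T),
      Module.Finite R T ∧ EvVan R T ∧ ∀ (N : Type u) [AddCommGroup N] [Module R N] (i : ℕ),
        Subsingleton (XE R T N (i+1)) ↔ Subsingleton (XE R W N (i+n+1)) := by
  induction n with
  | zero =>
    intro W _ _ _ h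
    exact ⟨W, inferInstance, inferInstance, inferInstance, h, fun N _ _ i => Iff.rfl⟩
  | succ n ih =>
    intro W _ _ _ h
    obtain ⟨T, _, _, hf, hT, H⟩ := ih W h
    obtain ⟨m, π, hπ⟩ := Module.Finite.exists_fin' R T
    have hF : EvVan R (Fin m → R) := by
      obtain ⟨D, hD⟩ := hR
      exact ⟨D, fun i hi => pi_van (hD i hi) m⟩
    refine ⟨LinearMap.ker π, inferInstance, inferInstance, inferInstance, hT.ker hF hπ, ?_⟩
    intro N _ _ i
    have e : i + (n+1) + 1 = (i+1) + n + 1 := by omega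
    rw [e, ← H]
    constructor
    · intro h1
      exact XE.sub_of_exact (XE.exc₃ (N := N) (SES.of_surj hπ) (i+1)) h1 (XE.projective_van (i+1))
    · intro h1
      exact XE.sub_of_exact (XE.exc₁ (N := N) (SES.of_surj hπ) (i+1)) (XE.projective_van i) h1

theorem gor_proj {d : ℕ} (hdim : ringKrullDim R = d)
    (hR : ∀ i, i ≠ d → Subsingleton (XE R (ResidueField R) R i))
    (W : Type u) [AddCommGroup W] [Module R W] [Module.Finite R W] (hW : EvVan R W)
    (hWW : ∀ i, Subsingleton (XE R W W (i+1))) : Module.Projective R W := by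
  obtain ⟨rs, hlen, hrs, hreg⟩ := rees_exists (n := d) R (fun i hi => hR i (by omega : i ≠ d))
  have hRE : EvVan R R := ⟨d, fun i hi => hR i (by omega)⟩
  obtain ⟨T, _, _, hf, hT, H⟩ := syz_exists hRE d W hW
  have hTp : Module.Projective R T := by
    obtain ⟨m, π, hπ⟩ := Module.Finite.exists_fin' R T
    have hF : EvVan R (Fin m → R) := ⟨d, fun i hi => pi_van (hR i (by omega)) m⟩
    obtain ⟨D, hD⟩ := hT.ker hF hπ
    refine proj_of_ext1 hπ ((H _ 0).2 ?_)
    exact PF (inj_bound hdim rs hlen hreg D fun i hi => hD i (by omega)) W _ (by omega)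
  have P : ∀ r, r ≤ d → ∀ (N : Type u) [AddCommGroup N] [Module R N] [Module.Finite R N] (i : ℕ),
      d - r < i → Subsingleton (XE R W N i) := by
    intro r
    induction r with
    | zero =>
      intro _ N _ _ _ i hi
      obtain ⟨j, rfl⟩ : ∃ j, i = j + d + 1 := ⟨i - d - 1, by omega⟩
      exact (H N j).1 (XE.projective_van j)
    | succ r ih =>
      intro hr N _ _ _ i hi
      refine cov_PF (c := d - (r+1)) (fun i hi => ?_) N i hi
      rcases subsingleton_or_nontrivial W with hs | hn
      · obtain ⟨j, rfl⟩ : ∃ j, i = j + 1 := ⟨i - 1, by omega⟩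
        exact XE.projective_van j
      obtain ⟨f, hfs⟩ := exists_surj_residue (R := R) (L := W)
      obtain ⟨j, rfl⟩ : ∃ j, i = j + 1 := ⟨i - 1, by omega⟩
      exact XE.sub_of_exact (XE.exv₃ (M := W) (SES.of_surj hfs) (j+1)) (hWW j)
        (ih (by omega) _ _ (by omega))
  obtain ⟨m, π, hπ⟩ := Module.Finite.exists_fin' R W
  exact proj_of_ext1 hπ (P d le_rfl _ 1 (by omega))

end CovPF


section PunctFree

/-- a free module whose endomorphisms are scalars has rank at most one -/
theorem free_rank_one {B : Type u} [CommRing B] [Nontrivial B] {W : Type u} [AddCommGroup W]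
    [Module B W] [Module.Free B W]
    (h : ∀ ψ : W →ₗ[B] W, ∃ b : B, ∀ w, ψ w = b • w) :
    ∃ (u' : W) (f' : W →ₗ[B] B), ∀ w, w = f' w • u' := by
  classical
  let b := Module.Free.chooseBasis B W
  have hs : Subsingleton (Module.Free.ChooseBasisIndex B W) := by
    refine ⟨fun i j => ?_⟩
    by_contra hij
    obtain ⟨c, hc⟩ := h (LinearMap.toSpanSingleton B W (b i) ∘ₗ b.coord i)
    have h1 := hc (b i)
    have h2 := hc (b j)
    simp only [LinearMap.comp_apply, LinearMap.toSpanSingleton_apply, Module.Basis.coord_apply,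
      Module.Basis.repr_self, Finsupp.single_eq_same, one_smul] at h1 h2
    have h3 := congrArg (fun z => b.repr z i) h1
    have h4 := congrArg (fun z => b.repr z j) h2
    simp [hij] at h3 h4
    exact one_ne_zero (h3.trans h4.symm)
  rcases isEmpty_or_nonempty (Module.Free.ChooseBasisIndex B W) with he | ⟨⟨i⟩⟩
  · have : Subsingleton W := b.repr.toEquiv.subsingleton
    exact ⟨0, 0, fun w => Subsingleton.elim _ _⟩
  · refine ⟨b i, b.coord i, fun w => ?_⟩
    apply b.repr.injective
    ext j
    rw [Subsingleton.elim j i]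
    simp

variable {R : Type u} [CommRing R] [IsNoetherianRing R]

theorem loc_residue (p : Ideal R) [hp : p.IsPrime] :
    Nonempty (LocalizedModule p.primeCompl (R ⧸ p) ≃ₗ[Localization.AtPrime p]
      ResidueField (Localization.AtPrime p)) := by
  let S := p.primeCompl
  let B := Localization.AtPrime p
  let T := LocalizedModule S (R ⧸ p)
  let g : T := LocalizedModule.mk 1 1
  let φ : B →ₗ[B] T := LinearMap.toSpanSingleton B T g
  have hφ : Function.Surjective φ := by
    intro t
    induction t using LocalizedModule.induction_on with
    | h m s =>
      obtain ⟨r, rfl⟩ := Ideal.Quotient.mk_surjective m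
      refine ⟨Localization.mk r s, ?_⟩
      rw [LinearMap.toSpanSingleton_apply, LocalizedModule.mk_smul_mk, mul_one]
      congr 1
      rw [Algebra.smul_def, mul_one]; rfl
  have hk : LinearMap.ker φ = maximalIdeal B := by
    apply le_antisymm
    · refine IsLocalRing.le_maximalIdeal (J := LinearMap.ker φ) fun htop => ?_
      have h1 : (1 : B) ∈ LinearMap.ker φ := by rw [htop]; trivial
      rw [LinearMap.mem_ker, LinearMap.toSpanSingleton_apply, one_smul] at h1
      obtain ⟨c, hc⟩ := (IsLocalizedModule.eq_zero_iff S (LocalizedModule.mkLinearMap S (R ⧸ p))).1 h1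
      refine c.2 (Ideal.Quotient.eq_zero_iff_mem.1 ?_)
      rw [Submonoid.smul_def, Algebra.smul_def, mul_one] at hc
      exact hc
    · rw [← Localization.AtPrime.map_eq_maximalIdeal, Ideal.map_le_iff_le_comap]
      intro r hr
      change φ (algebraMap R B r) = 0
      rw [LinearMap.toSpanSingleton_apply, algebraMap_smul, LocalizedModule.smul'_mk]
      have : r • (1 : R ⧸ p) = 0 := by
        rw [Algebra.smul_def, mul_one]
        exact Ideal.Quotient.eq_zero_iff_mem.2 hr
      rw [this, LocalizedModule.zero_mk]
  exact ⟨(LinearMap.quotKerEquivOfSurjective φ hφ).symm.trans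
    (Submodule.quotEquivOfEq _ _ hk)⟩

theorem punct_spread [IsLocalRing R] {W : Type u} [AddCommGroup W] [Module R W] [Module.Finite R W]
    {d : ℕ} (hk : ∀ i, d < i → Subsingleton (XE R (ResidueField R) W i))
    (hWW : ∀ i, Subsingleton (XE R W W (i+1)))
    (hend : ∀ φ : W →ₗ[R] W, ∃ r : R, ∀ w, φ w = r • w)
    (p : Ideal R) [hp : p.IsPrime] (hG : IsGorensteinLocal (Localization.AtPrime p)) :
    ∃ s ∉ p, ∃ (u : W) (f : W →ₗ[R] R), ∀ w, s • w = f w • u := by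
  obtain ⟨hN, d', hdim, _, hG1, hG2⟩ := hG
  let S := p.primeCompl
  let B := Localization.AtPrime p
  obtain ⟨e⟩ := loc_residue p
  have hB : ∀ i, i ≠ d' → Subsingleton (XE B (ResidueField B) B i) := fun i hi => by
    obtain ⟨e⟩ := nonempty_extMod (R := B) (M := ResidueField B) (N := B) i
    have := hG1 i hi
    exact e.symm.toEquiv.subsingleton
  have hE : EvVan B (LocalizedModule S W) := by
    refine ⟨d, fun i hi => ?_⟩
    obtain ⟨j, rfl⟩ : ∃ j, i = j + 1 := ⟨i - 1, by omega⟩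
    exact XE.van_left e (loc_ext_van S j (R ⧸ p) W (PF hk (R ⧸ p) (j+1) hi))
  have hP : Module.Projective B (LocalizedModule S W) :=
    gor_proj hdim hB (LocalizedModule S W) hE fun i => loc_ext_van S i W W (hWW i)
  have hF : Module.Free B (LocalizedModule S W) := Module.free_of_flat_of_isLocalRing
  obtain ⟨u', f', h⟩ := free_rank_one (B := B) (W := LocalizedModule S W) (loc_end S hend)
  exact loc_spread S u' f' h

end PunctFree


section Tens

open TensorProduct

variable {R : Type u} [CommRing R]

theorem pi_van_left {M N : Type u} [AddCommGroup M] [Module R M] [AddCommGroup N] [Module R N]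
    {i : ℕ} (h : Subsingleton (XE R M N i)) (n : ℕ) : Subsingleton (XE R (Fin n → M) N i) := by
  induction n with
  | zero =>
    refine subsingleton_of_forall_eq 0 fun x => ?_
    rw [← XE.pre_id i x]
    have : (LinearMap.id : (Fin 0 → M) →ₗ[R] (Fin 0 → M)) = (0 : R) • LinearMap.id :=
      LinearMap.ext fun _ => Subsingleton.elim _ _
    rw [this, XE.pre_smul_id, zero_smul]
  | succ n ih =>
    have hs : SES (LinearMap.single R (fun _ : Fin (n+1) => M) 0)
        (LinearMap.funLeft R M (Fin.succ : Fin n → Fin (n+1))) := by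
      refine ⟨Pi.single_injective (M := fun _ : Fin (n+1) => M) 0,
        fun f => ⟨fun hf => ⟨f 0, ?_⟩, ?_⟩, fun f => ⟨Fin.cons 0 f, ?_⟩⟩
      · ext j
        refine Fin.cases ?_ (fun j => ?_) j
        · simp
        · have := congrFun hf j
          simp [LinearMap.funLeft_apply] at this
          simp [this]
      · rintro ⟨x, rfl⟩
        ext j
        simp [LinearMap.funLeft_apply]
      · ext j
        simp [LinearMap.funLeft_apply]
    exact XE.sub_of_exact (XE.exc₂ (N := N) hs i) ih h

theorem fl_of_spread [IsNoetherianRing R] [IsLocalRing R] {M : Type u} [AddCommGroup M]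
    [Module R M] [Module.Finite R M]
    (h : ∀ p : Ideal R, p.IsPrime → p ≠ maximalIdeal R → ∃ s ∉ p, ∀ m : M, s • m = 0) :
    IsFiniteLength R M := by
  refine fl_of_ann (Module.annihilator R M) (fun j hj => Module.mem_annihilator.1 hj)
    fun q hq hle => ?_
  by_contra hne
  obtain ⟨s, hs, hs2⟩ := h q hq hne
  exact hs (hle (Module.mem_annihilator.2 hs2))

/-- multiplication by `s` on the tensor product factors through the second factor -/
theorem tens_factor {W : Type u} [AddCommGroup W] [Module R W] {s : R} {u : W} {f : W →ₗ[R] R}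
    (h : ∀ w, s • w = f w • u) {N : Type u} [AddCommGroup N] [Module R N] (z : W ⊗[R] N) :
    s • z = u ⊗ₜ[R] (TensorProduct.lid R N (f.rTensor N z)) := by
  induction z using TensorProduct.induction_on with
  | zero => simp
  | tmul w n =>
    rw [LinearMap.rTensor_tmul, TensorProduct.lid_tmul, TensorProduct.smul_tmul', h,
      TensorProduct.smul_tmul]
  | add a b ha hb => rw [smul_add, ha, hb, map_add, map_add, TensorProduct.tmul_add]

theorem tens_ker {W : Type u} [AddCommGroup W] [Module R W] {s : R} {u : W} {f : W →ₗ[R] R}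
    (h : ∀ w, s • w = f w • u) {N P : Type u} [AddCommGroup N] [Module R N] [AddCommGroup P]
    [Module R P] {j : N →ₗ[R] P} (hj : Function.Injective j) (z : W ⊗[R] N)
    (hz : j.lTensor W z = 0) : s • z = 0 := by
  rw [tens_factor h]
  have : ∀ z : W ⊗[R] N, j (TensorProduct.lid R N (f.rTensor N z)) =
      TensorProduct.lid R P (f.rTensor P (j.lTensor W z)) := by
    intro z
    induction z using TensorProduct.induction_on with
    | zero => simp
    | tmul w n => simp
    | add a b ha hb => simp only [map_add, ha, hb]
  have this := this z
  rw [hz, map_zero, map_zero] at this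
  rw [hj (this.trans (map_zero j).symm), TensorProduct.tmul_zero]

variable [IsNoetherianRing R] [IsLocalRing R]

theorem tens_claim {W : Type u} [AddCommGroup W] [Module R W] [Module.Finite R W] {d : ℕ}
    (hsp : ∀ p : Ideal R, p.IsPrime → p ≠ maximalIdeal R →
      ∃ s ∉ p, ∃ (u : W) (f : W →ₗ[R] R), ∀ w, s • w = f w • u)
    (hlow : ∀ i, i < d → Subsingleton (XE R (ResidueField R) W i))
    (hWW : ∀ i, Subsingleton (XE R W W (i+1)))
    (hend : Function.Bijective (LinearMap.lsmul R W : R →ₗ[R] (W →ₗ[R] W))) (a : R) (i : ℕ) :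
    i < d → ∀ (N : Type u) [AddCommGroup N] [Module R N] [Module.Finite R N]
      (_ : ∀ x : XE R N R (i+1), a • x = 0), ∀ x : XE R (W ⊗[R] N) W (i+1), a • x = 0 := by
  have hP : ∀ n i, Subsingleton (XE R (W ⊗[R] (Fin n → R)) W (i+1)) := fun n i =>
    XE.van_left (TensorProduct.piScalarRight R R W (Fin n)).symm (pi_van_left (hWW i) n)
  induction i with
  | zero =>
    intro _ N _ _ _ ha y
    obtain ⟨n, π, hπ⟩ := Module.Finite.exists_fin' R N
    have hs := SES.of_surj hπ
    let ι : LinearMap.ker π →ₗ[R] (Fin n → R) := (LinearMap.ker π).subtype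
    let I := LinearMap.range (ι.lTensor W)
    have hsT : SES I.subtype (π.lTensor W) := by
      refine ⟨I.injective_subtype, ?_, LinearMap.lTensor_surjective W hπ⟩
      have h1 := lTensor_exact W hs.ex hπ
      intro z
      rw [h1 z]
      simp [I, ι]
    obtain ⟨z, rfl⟩ := XE.surj_of_exact (XE.exc₃ (N := W) hsT 0) (hP n 0) y
    obtain ⟨φ, rfl⟩ := XE.zeroEquiv.symm.surjective z
    let E : R ≃ₗ[R] (W →ₗ[R] W) := LinearEquiv.ofBijective _ hend
    let ψ0 : LinearMap.ker π →ₗ[R] (W →ₗ[R] W) :=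
      (TensorProduct.mk R W (LinearMap.ker π)).flip.compr₂ (φ ∘ₗ (ι.lTensor W).rangeRestrict)
    let ψ : LinearMap.ker π →ₗ[R] R := E.symm.toLinearMap ∘ₗ ψ0
    have h1 : XE.dc R hs 0 (a • XE.zeroEquiv.symm ψ) = 0 := by rw [map_smul]; exact ha _
    obtain ⟨y, hy⟩ := (XE.exc₁ hs 0 _).1 h1
    obtain ⟨χ, rfl⟩ := XE.zeroEquiv.symm.surjective y
    rw [XE.pre_zero, ← map_smul] at hy
    have hy2 : χ ∘ₗ (LinearMap.ker π).subtype = a • ψ := XE.zeroEquiv.symm.injective hy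
    rw [← map_smul, ← map_smul, (XE.exc₁ hsT 0) _]
    refine ⟨XE.zeroEquiv.symm (TensorProduct.rid R W ∘ₗ χ.lTensor W), ?_⟩
    rw [XE.pre_zero]
    congr 1
    ext ⟨_, z, rfl⟩
    change TensorProduct.rid R W (χ.lTensor W (ι.lTensor W z)) =
      a • φ ((ι.lTensor W).rangeRestrict z)
    induction z using TensorProduct.induction_on with
    | zero => simp
    | tmul w k =>
      rw [LinearMap.lTensor_tmul, LinearMap.lTensor_tmul, TensorProduct.rid_tmul]
      have e1 : χ (ι k) = a • ψ k := LinearMap.congr_fun hy2 k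
      have e2 : ψ k • w = ψ0 k w := by
        have : E (ψ k) = ψ0 k := E.apply_symm_apply _
        exact LinearMap.congr_fun this w
      rw [e1, smul_assoc, e2]
      rfl
    | add b c hb hc => simp only [map_add, smul_add, hb, hc]
  | succ i ih =>
    intro hi N _ _ _ ha y
    obtain ⟨n, π, hπ⟩ := Module.Finite.exists_fin' R N
    have hs := SES.of_surj hπ
    let ι : LinearMap.ker π →ₗ[R] (Fin n → R) := (LinearMap.ker π).subtype
    let I := LinearMap.range (ι.lTensor W)
    have hsT : SES I.subtype (π.lTensor W) := by
      refine ⟨I.injective_subtype, ?_, LinearMap.lTensor_surjective W hπ⟩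
      have h1 := lTensor_exact W hs.ex hπ
      intro z
      rw [h1 z]
      simp [I, ι]
    have h1 : ∀ x : XE R (LinearMap.ker π) R (i+1), a • x = 0 := by
      intro x
      have hinj := XE.inj_of_exact (XE.exc₁ (N := R) hs (i+1)) (XE.projective_van i)
      apply hinj
      rw [map_smul, map_zero]
      exact ha _
    have h2 := ih (by omega) (LinearMap.ker π) h1
    have hsK := SES.of_surj (ι.lTensor W).surjective_rangeRestrict
    have hK : IsFiniteLength R (LinearMap.ker (ι.lTensor W).rangeRestrict) := by
      refine fl_of_spread fun p hp hpm => ?_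
      obtain ⟨s, hsp, u, f, h⟩ := hsp p hp hpm
      refine ⟨s, hsp, fun z => Subtype.ext ?_⟩
      have hz := z.2
      rw [LinearMap.mem_ker] at hz
      exact tens_ker h (LinearMap.ker π).injective_subtype z.1 (congrArg Subtype.val hz)
    have hKv := fl_van (hlow i (by omega)) hK
    have hinj := XE.inj_of_exact (XE.exc₃ (N := W) hsK i) hKv
    obtain ⟨z, rfl⟩ := XE.surj_of_exact (XE.exc₃ (N := W) hsT (i+1)) (hP n (i+1)) y
    have hz : a • z = 0 := by
      apply hinj
      rw [map_smul, map_zero]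
      exact h2 _
    rw [← map_smul, hz, map_zero]

end Tens


section Final

open TensorProduct

variable {R : Type u} [CommRing R]

/-- factorisation from the vanishing of the antisymmetric tensor -/
theorem factor_of_antisymm {W : Type u} [AddCommGroup W] [Module R W] {x y : W}
    (hxy : Submodule.span R {x, y} = ⊤) (hf : ∀ c : R, (∀ w : W, c • w = 0) → c = 0) {a : R}
    (ha : a • (x ⊗ₜ[R] y - y ⊗ₜ[R] x) = 0) :
    ∃ (k : ℕ) (g : W →ₗ[R] (Fin k → R)) (h : (Fin k → R) →ₗ[R] W),
      h ∘ₗ g = a • (LinearMap.id : W →ₗ[R] W) := by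
  have hspan : ∀ w : W, ∃ α β : R, α • x + β • y = w := fun w => by
    have : w ∈ Submodule.span R {x, y} := by rw [hxy]; trivial
    exact Submodule.mem_span_pair.1 this
  obtain ⟨k, A, w, h1, h2⟩ := TensorProduct.vanishesTrivially_of_sum_tmul_eq_zero R
    (m := ![x, y]) (n := ![a • y, -(a • x)]) (by simpa [Set.pair_comm] using hxy) (by
      rw [smul_sub] at ha
      simpa [TensorProduct.tmul_neg, sub_eq_add_neg] using ha)
  have h1x : a • y = ∑ j, A 0 j • w j := h1 0
  have h1y : -(a • x) = ∑ j, A 1 j • w j := h1 1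
  have h2 : ∀ j, A 0 j • x + A 1 j • y = 0 := fun j => by simpa using h2 j
  let π : (R × R) →ₗ[R] W :=
    (LinearMap.toSpanSingleton R W x).coprod (LinearMap.toSpanSingleton R W y)
  have hπa : ∀ α β, π (α, β) = α • x + β • y := fun α β => rfl
  have hπ : Function.Surjective π := fun w => by
    obtain ⟨α, β, h⟩ := hspan w
    exact ⟨(α, β), h⟩
  let G : (R × R) →ₗ[R] (Fin k → R) :=
    (LinearMap.toSpanSingleton R (Fin k → R) (fun j => -A 1 j)).coprod
      (LinearMap.toSpanSingleton R (Fin k → R) (fun j => A 0 j))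
  have hG : ∀ α β j, G (α, β) j = α * -A 1 j + β * A 0 j := fun α β j => rfl
  have hker : LinearMap.ker π ≤ LinearMap.ker G := by
    rintro ⟨α, β⟩ hz
    rw [LinearMap.mem_ker, hπa] at hz
    rw [LinearMap.mem_ker]
    funext j
    rw [hG]
    refine hf _ fun w => ?_
    obtain ⟨γ, δ, rfl⟩ := hspan w
    have ex : (α * -A 1 j + β * A 0 j) • x =
        (-A 1 j) • (α • x + β • y) + β • (A 0 j • x + A 1 j • y) := by module
    have ey : (α * -A 1 j + β * A 0 j) • y =
        A 0 j • (α • x + β • y) - α • (A 0 j • x + A 1 j • y) := by module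
    rw [hz, h2, smul_zero, smul_zero] at ex ey
    rw [smul_add, smul_comm _ γ, smul_comm _ δ, ex, ey]
    simp
  let g : W →ₗ[R] (Fin k → R) := (LinearMap.ker π).liftQ G hker ∘ₗ
    (LinearMap.quotKerEquivOfSurjective π hπ).symm.toLinearMap
  have hg : ∀ z, g (π z) = G z := fun z => by
    have : (LinearMap.quotKerEquivOfSurjective π hπ).symm (π z) = (LinearMap.ker π).mkQ z := by
      rw [LinearEquiv.symm_apply_eq]; rfl
    change (LinearMap.ker π).liftQ G hker ((LinearMap.quotKerEquivOfSurjective π hπ).symm (π z)) = _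
    rw [this]; rfl
  refine ⟨k, g, Fintype.linearCombination R w, ?_⟩
  ext v
  obtain ⟨⟨α, β⟩, rfl⟩ := hπ v
  rw [LinearMap.comp_apply, hg, Fintype.linearCombination_apply]
  simp only [hG, add_smul, Finset.sum_add_distrib, mul_smul, neg_smul, ← Finset.smul_sum,
    Finset.sum_neg_distrib, ← h1x, ← h1y, hπa, LinearMap.smul_apply, LinearMap.id_apply, smul_add,
    neg_neg, smul_comm a]

/-- an element factoring through a free module kills Ext -/
theorem kill_of_factor {W F N : Type u} [AddCommGroup W] [Module R W] [AddCommGroup F] [Module R F]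
    [AddCommGroup N] [Module R N] [Module.Projective R F] {a : R} {g : W →ₗ[R] F} {h : F →ₗ[R] W}
    (e : h ∘ₗ g = a • (LinearMap.id : W →ₗ[R] W)) (i : ℕ) (x : XE R W N (i+1)) : a • x = 0 := by
  rw [← XE.pre_smul_id, ← e, XE.pre_comp]
  have : Subsingleton (XE R F N (i+1)) := XE.projective_van i
  rw [Subsingleton.elim (XE.pre N h (i+1) x) 0, map_zero]

theorem factor_of_syz {W S : Type u} [AddCommGroup W] [Module R W] [AddCommGroup S] [Module R S]
    (hS : IsSyzygy R W S) {a : R} (ha : ∀ x : XE R W S 1, a • x = 0)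
    (N : Type u) [AddCommGroup N] [Module R N] (i : ℕ) (x : XE R W N (i+1)) : a • x = 0 := by
  obtain ⟨F, _, _, ι, π, hF, hFf, hι, hπ, hr⟩ := hS
  have hs : SES ι π := ⟨hι, LinearMap.exact_iff.2 hr.symm, hπ⟩
  have h1 : XE.dv W hs 0 (a • XE.zeroEquiv.symm LinearMap.id) = 0 := by rw [map_smul]; exact ha _
  obtain ⟨y, hy⟩ := (XE.exv₃ (M := W) hs 0 _).1 h1
  obtain ⟨χ, rfl⟩ := XE.zeroEquiv.symm.surjective y
  rw [XE.post_zero, ← map_smul] at hy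
  exact kill_of_factor (XE.zeroEquiv.symm.injective hy) i x

end Final


section Hard

open TensorProduct RingTheory.Sequence

variable {R : Type u} [CommRing R] [IsNoetherianRing R] [IsLocalRing R]

theorem reg_seq {d : ℕ} (hCM : moduleDepth R R = (d : ℕ∞)) :
    ∃ rs : List R, rs.length = d ∧ (∀ r ∈ rs, r ∈ maximalIdeal R) ∧ IsRegular R rs := by
  unfold moduleDepth at hCM
  have hne : Nonempty {n : ℕ∞ | ∃ rs : List R,
      (∀ r ∈ rs, r ∈ maximalIdeal R) ∧ IsRegular R rs ∧ (rs.length : ℕ∞) = n} :=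
    ⟨⟨0, [], by simp, IsRegular.nil R R, by simp⟩⟩
  have h := ENat.sSup_mem_of_nonempty_of_lt_top (s := {n : ℕ∞ | ∃ rs : List R,
    (∀ r ∈ rs, r ∈ maximalIdeal R) ∧ IsRegular R rs ∧ (rs.length : ℕ∞) = n})
    (by rw [hCM]; exact ENat.natCast_lt_top d)
  rw [hCM] at h
  obtain ⟨rs, h1, h2, h3⟩ := h
  exact ⟨rs, by exact_mod_cast h3, h1, h2⟩

/-- a sequence regular on the ring and on the module simultaneously -/
theorem common_seq {d : ℕ} (hCM : moduleDepth R R = (d : ℕ∞)) {W : Type u} [AddCommGroup W]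
    [Module R W] [Module.Finite R W]
    (hlow : ∀ i, i < d → Subsingleton (XE R (ResidueField R) W i)) :
    ∃ rs : List R, rs.length = d ∧ (∀ r ∈ rs, r ∈ maximalIdeal R) ∧ IsRegular R rs ∧
      IsWeaklyRegular W rs := by
  obtain ⟨rs, hlen, hrs, hreg⟩ := reg_seq hCM
  have h1 : ∀ i < d, Subsingleton (XE R (ResidueField R) R i) := by
    intro i hi
    exact rees_van R rs hrs hreg i (by omega)
  have hs : SES (LinearMap.inl R R W) (LinearMap.snd R R W) :=
    ⟨LinearMap.inl_injective, by
      intro z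
      constructor
      · intro hz
        exact ⟨z.1, Prod.ext rfl hz.symm⟩
      · rintro ⟨y, rfl⟩; rfl, LinearMap.snd_surjective⟩
  obtain ⟨xs, hxl, hxm, hxr⟩ := rees_exists (n := d) (R × W) fun i hi =>
    XE.sub_of_exact (XE.exv₂ (M := ResidueField R) hs i) (h1 i hi) (hlow i hi)
  have hwR : IsWeaklyRegular R xs :=
    wr_retract xs (LinearMap.inl R R W) (LinearMap.fst R R W) rfl hxr.toIsWeaklyRegular
  have hwW : IsWeaklyRegular W xs :=
    wr_retract xs (LinearMap.inr R R W) (LinearMap.snd R R W) rfl hxr.toIsWeaklyRegular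
  refine ⟨xs, hxl, hxm, ⟨hwR, fun ht => ?_⟩, hwW⟩
  have h3 : Ideal.ofList xs • (⊤ : Submodule R R) ≤ maximalIdeal R := by
    refine (Submodule.smul_le.2 fun r hr n _ => ?_)
    have : Ideal.ofList xs ≤ maximalIdeal R := Ideal.span_le.2 fun r hr => hxm r hr
    exact Ideal.mul_mem_right _ _ (this hr)
  rw [← ht] at h3
  exact (IsLocalRing.maximalIdeal.isMaximal R).ne_top (top_le_iff.1 h3)

theorem hard_incl {e : ℕ} (hdim : ringKrullDim R = (e + 1 : ℕ))
    (hCM : moduleDepth R R = ((e + 1 : ℕ) : ℕ∞))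
    {W : Type u} [AddCommGroup W] [Module R W] [Module.Finite R W]
    (hv : ∀ i, i ≠ e + 1 → Subsingleton (XE R (ResidueField R) W i))
    (h1 : Nonempty (XE R (ResidueField R) W (e+1) ≃ₗ[R] ResidueField R))
    {x y : W} (hxy : Submodule.span R {x, y} = ⊤)
    (hpunct : ∀ (p : Ideal R) (hp : p.IsPrime), p ≠ maximalIdeal R →
      IsGorensteinLocal (Localization.AtPrime p)) {a : R}
    (ha : ∀ x : XE R W (W × R) (e+1), a • x = 0)
    (N : Type u) [AddCommGroup N] [Module R N] (i : ℕ) (z : XE R W N (i+1)) : a • z = 0 := by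
  obtain ⟨rs, hlen, hrs, hR, hW⟩ := common_seq hCM (W := W) fun i hi => hv i (by omega)
  have hend := end_omega hdim rs hlen hrs hR hW (hv e (by omega)) h1 (hv _ (by omega))
  have hPF : ∀ (M : Type u) [AddCommGroup M] [Module R M] [Module.Finite R M] (i : ℕ), e + 1 < i →
      Subsingleton (XE R M W i) := fun M _ _ _ i hi => PF (c := e+1) (fun i hi => hv i (by omega)) M i hi
  have hWW : ∀ i, Subsingleton (XE R W W (i+1)) := fun i =>
    wr_van_down rs hrs hPF W hW (i+1) (by omega)
  have hsp : ∀ p : Ideal R, p.IsPrime → p ≠ maximalIdeal R →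
      ∃ s ∉ p, ∃ (u : W) (f : W →ₗ[R] R), ∀ w, s • w = f w • u := by
    intro p hp hpm
    refine punct_spread (d := e+1) (fun i hi => hv i (by omega)) hWW (fun φ => ?_) p (hpunct p hp hpm)
    obtain ⟨r, hr⟩ := hend.2 φ
    exact ⟨r, fun w => by rw [← hr]; rfl⟩
  -- kill Ext into the ring
  have ha1 : ∀ t : XE R W R (e+1), a • t = 0 := fun t => by
    have h2 := congrArg (XE.post W (LinearMap.snd R W R) (e+1)) (ha (XE.post W (LinearMap.inr R W R) (e+1) t))
    rw [map_smul, ← XE.post_comp, map_zero] at h2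
    have h3 : LinearMap.snd R W R ∘ₗ LinearMap.inr R W R = LinearMap.id := rfl
    rwa [h3, XE.post_id] at h2
  have ha2 := tens_claim hsp (fun i hi => hv i (by omega)) hWW hend a e (Nat.lt_succ_self e) W ha1
  let g : W ⊗[R] W := x ⊗ₜ[R] y - y ⊗ₜ[R] x
  let T : Submodule R (W ⊗[R] W) := R ∙ g
  have hT : IsFiniteLength R T := by
    refine fl_of_spread fun p hp hpm => ?_
    obtain ⟨s, hs, u, f, h⟩ := hsp p hp hpm
    refine ⟨s * s, fun hss => (hp.mem_or_mem hss).elim hs hs, fun ⟨t, ht⟩ => Subtype.ext ?_⟩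
    obtain ⟨c, rfl⟩ := Submodule.mem_span_singleton.1 ht
    have e1 : ∀ v w : W, (s * s) • (v ⊗ₜ[R] w) = (f v * f w) • (u ⊗ₜ[R] u) := fun v w => by
      rw [← TensorProduct.smul_tmul_smul, h, h, TensorProduct.smul_tmul_smul]
    change (s * s) • (c • g) = 0
    rw [smul_comm, smul_sub, e1, e1, mul_comm, sub_self, smul_zero]
  have hTs : Function.Surjective (XE.pre W T.subtype (e+1)) :=
    XE.surj_of_exact (XE.exc₁ (N := W) (SES.of_submodule T) (e+1)) (hPF _ _ (by omega))
  have ha3 : ∀ t : XE R T W (e+1), a • t = 0 := fun t => by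
    obtain ⟨t, rfl⟩ := hTs t
    rw [← map_smul, ha2, map_zero]
  have hns : ¬ Subsingleton (XE R (ResidueField R) W (e+1)) := fun hsub => by
    obtain ⟨E⟩ := h1
    exact not_subsingleton (ResidueField R) E.symm.toEquiv.subsingleton
  have ha4 := fl_ann (hv e (by omega)) hns (hv (e+2) (by omega)) hT ha3
    ⟨g, Submodule.mem_span_singleton_self g⟩
  have ha5 : a • g = 0 := congrArg Subtype.val ha4
  obtain ⟨k, G, H, hGH⟩ := factor_of_antisymm hxy (fun c hc => by
    apply hend.1
    rw [map_zero]
    ext w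
    exact hc w) ha5
  exact kill_of_factor hGH i z

end Hard

/-- For a Cohen–Macaulay local ring of type 2, Gorenstein on the punctured spectrum,
of dimension `d ≥ 2`, the stable annihilator of the canonical module `ω` equals its
Auslander–Reiten annihilator. -/
theorem stmt17 (R : Type u) [CommRing R] [IsNoetherianRing R] [IsLocalRing R]
    (d : ℕ) (hd : 2 ≤ d) (hdim : ringKrullDim R = (d : ℕ))
    (hCM : moduleDepth R R = (d : ℕ∞))
    (ω : Type u) [AddCommGroup ω] [Module R ω] (hω : IsCanonicalModule R d ω)
    -- `R` has (Cohen–Macaulay) type 2: `ω` is minimally generated by 2 elements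
    (htype : (∃ s : Finset ω, s.card = 2 ∧ Submodule.span R (s : Set ω) = ⊤) ∧
      ∀ t : Finset ω, Submodule.span R (t : Set ω) = ⊤ → 2 ≤ t.card)
    (hpunct : ∀ (p : Ideal R) (hp : p.IsPrime), p ≠ maximalIdeal R →
      IsGorensteinLocal (Localization.AtPrime p))
    (S : Type u) [AddCommGroup S] [Module R S] (hS : IsSyzygy R ω S) :
    extAnn R 1 ω S = ARann R ω := by
  obtain ⟨e, rfl⟩ : ∃ e, d = e + 1 := ⟨d - 1, by omega⟩
  obtain ⟨hfin, hv0, ⟨E⟩⟩ := hω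
  have hv : ∀ i, i ≠ e + 1 → Subsingleton (XE R (ResidueField R) ω i) := fun i hi => by
    obtain ⟨E'⟩ := nonempty_extMod (R := R) (M := ResidueField R) (N := ω) i
    have := hv0 i hi
    exact E'.symm.toEquiv.subsingleton
  have h1 : Nonempty (XE R (ResidueField R) ω (e+1) ≃ₗ[R] ResidueField R) := by
    obtain ⟨E'⟩ := nonempty_extMod (R := R) (M := ResidueField R) (N := ω) (e+1)
    exact ⟨E'.symm.trans E⟩
  classical
  obtain ⟨⟨s, hs, hspan⟩, -⟩ := htype
  obtain ⟨x, y, hne, rfl⟩ := Finset.card_eq_two.1 hs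
  have hxy : Submodule.span R {x, y} = ⊤ := by simpa using hspan
  ext a
  unfold ARann
  rw [Submodule.mem_iInf]
  constructor
  · intro ha i
    exact mem_extAnn.2 (factor_of_syz hS (mem_extAnn.1 ha) _ i)
  · intro ha
    exact mem_extAnn.2 (hard_incl hdim hCM hv h1 hxy hpunct (mem_extAnn.1 (ha e)) S 0)
end

section
/- Let R be a commutative Noetherian local ring, X a class of finitely generated R-modules, and suppose M lies in |X|_r, the class built from X by r-fold extensions and direct summands. Then for any R-module Y, the r-th power of the ideal ⋂_{X∈X} ann_R Ext^1_R(X,Y) annihilates Ext^1_R(M,Y). -/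
open CategoryTheory Opposite IsLocalRing

universe u

variable (R : Type u) [CommRing R]

/-- The modules that are direct summands of finite direct sums of modules in `X`
(the additive closure `add X`). -/
def addClos (X : Set (ModuleCat.{u} R)) : Set (ModuleCat.{u} R) :=
  {M | ∃ (n : ℕ) (f : Fin n → ModuleCat.{u} R) (C : ModuleCat.{u} R),
    (∀ i, f i ∈ X) ∧ Nonempty ((∀ i, ↥(f i)) ≃ₗ[R] (↥M × ↥C))}

/-- `X₁ * X₂`: direct summands of middle terms of extensions of `add X₂` by
`add X₁`. -/
def starCat (X₁ X₂ : Set (ModuleCat.{u} R)) : Set (ModuleCat.{u} R) :=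
  {M | ∃ (A E B : ModuleCat.{u} R), A ∈ addClos R X₁ ∧ B ∈ addClos R X₂ ∧
    (∃ (f : ↥A →ₗ[R] ↥E) (g : ↥E →ₗ[R] ↥B), Function.Injective f ∧
      Function.Surjective g ∧ LinearMap.range f = LinearMap.ker g) ∧
    ∃ C : ModuleCat.{u} R, Nonempty (↥E ≃ₗ[R] (↥M × ↥C))}

/-- The balls `|X|_r`: `|X|₁ = add X` and `|X|_{r+1} = |X|_r * X`. -/
def ball (X : Set (ModuleCat.{u} R)) : ℕ → Set (ModuleCat.{u} R)
  | 0 => ∅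
  | 1 => addClos R X
  | (r + 2) => starCat R (ball X (r + 1)) X

/-- Every map from the kernel of a surjection onto `M` extends after multiplication by `a`. -/
def GoodElt (R : Type u) [CommRing R] (Y : Type u) [AddCommGroup Y] [Module R Y] (a : R)
    (M : Type u) [AddCommGroup M] [Module R M] : Prop :=
  ∀ (Q : Type u) [AddCommGroup Q] [Module R Q] (p : Q →ₗ[R] M), Function.Surjective p →
    ∀ φ : LinearMap.ker p →ₗ[R] Y, ∃ g : Q →ₗ[R] Y, ∀ k : LinearMap.ker p, g k = a • φ k

lemma exists_descend {R : Type u} [CommRing R] {A Q Y : Type u} [AddCommGroup A] [Module R A]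
    [AddCommGroup Q] [Module R Q] [AddCommGroup Y] [Module R Y]
    (f : A →ₗ[R] Q) (hf : Function.Surjective f) (g : A →ₗ[R] Y)
    (h : ∀ x, f x = 0 → g x = 0) : ∃ G : Q →ₗ[R] Y, ∀ x, G (f x) = g x := by
  have hk : LinearMap.ker f ≤ LinearMap.ker g := fun x hx => h x hx
  refine ⟨(LinearMap.ker f).liftQ g hk ∘ₗ (f.quotKerEquivOfSurjective hf).symm.toLinearMap, ?_⟩
  intro x
  have : (f.quotKerEquivOfSurjective hf).symm (f x) = Submodule.Quotient.mk x := by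
    rw [LinearEquiv.symm_apply_eq]; rfl
  simp [this]

lemma goodElt_of_retract {R : Type u} [CommRing R] {Y : Type u} [AddCommGroup Y] [Module R Y]
    {a : R} {E M : Type u} [AddCommGroup M] [Module R M] [AddCommGroup E] [Module R E]
    (j : M →ₗ[R] E) (q : E →ₗ[R] M) (hq : ∀ x, q (j x) = x) (hE : GoodElt R Y a E) :
    GoodElt R Y a M := by
  intro Q _ _ p hp φ
  let P : Q × LinearMap.ker q →ₗ[R] E := (j ∘ₗ p).coprod (LinearMap.ker q).subtype
  have hP : Function.Surjective P := by
    intro e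
    obtain ⟨x, hx⟩ := hp (q e)
    refine ⟨(x, ⟨e - j (q e), by simp [hq]⟩), ?_⟩
    simp [P, hx]
  have h1 : ∀ z : LinearMap.ker P, p z.1.1 = 0 := by
    rintro ⟨⟨x, c⟩, hz⟩
    have : q (P (x, c)) = 0 := by rw [LinearMap.mem_ker.mp hz, map_zero]
    simpa [P, hq] using this
  let t : LinearMap.ker P →ₗ[R] LinearMap.ker p :=
    (LinearMap.fst R Q _ ∘ₗ (LinearMap.ker P).subtype).codRestrict _ h1
  obtain ⟨g, hg⟩ := hE _ P hP (φ ∘ₗ t)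
  refine ⟨g ∘ₗ LinearMap.inl R _ _, fun k => ?_⟩
  have hk : P (k.1, 0) = 0 := by simp [P]
  exact hg ⟨(k.1, 0), hk⟩

lemma goodElt_pi {R : Type u} [CommRing R] {Y : Type u} [AddCommGroup Y] [Module R Y]
    {a : R} {n : ℕ} (M : Fin n → Type u) [∀ i, AddCommGroup (M i)] [∀ i, Module R (M i)]
    (h : ∀ i, GoodElt R Y a (M i)) : GoodElt R Y a (∀ i, M i) := by
  intro Q _ _ p hp φ
  let N : Fin n → Submodule R Q := fun i =>
    (LinearMap.range (LinearMap.single R M i)).comap p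
  let pr : ∀ i, N i →ₗ[R] M i := fun i => LinearMap.proj i ∘ₗ p ∘ₗ (N i).subtype
  have hpr : ∀ i, Function.Surjective (pr i) := by
    intro i m
    obtain ⟨x, hx⟩ := hp (Pi.single i m)
    exact ⟨⟨x, ⟨m, by simp [hx]⟩⟩, by simp [pr, hx]⟩
  have hker : ∀ i (z : N i), pr i z = 0 → p z = 0 := by
    rintro i ⟨x, m, hm⟩ hz
    have : m = 0 := by simpa [pr, ← hm] using hz
    simp [← hm, this]
  have key : ∀ i, ∃ g : N i →ₗ[R] Y, ∀ (z : N i) (hz : p z = 0), g z = a • φ ⟨z, hz⟩ := by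
    intro i
    let t : LinearMap.ker (pr i) →ₗ[R] LinearMap.ker p :=
      ((N i).subtype ∘ₗ (LinearMap.ker (pr i)).subtype).codRestrict _
        (fun z => hker i z.1 z.2)
    obtain ⟨g, hg⟩ := h i _ (pr i) (hpr i) (φ ∘ₗ t)
    refine ⟨g, fun z hz => ?_⟩
    exact hg ⟨z, by simp [pr, hz]⟩
  choose g hg using key
  let F : (∀ i, N i) × LinearMap.ker p →ₗ[R] Q :=
    (∑ i, (N i).subtype ∘ₗ LinearMap.proj i).coprod (LinearMap.ker p).subtype
  let G : (∀ i, N i) × LinearMap.ker p →ₗ[R] Y :=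
    (∑ i, g i ∘ₗ LinearMap.proj i).coprod (a • φ)
  have hF : Function.Surjective F := by
    intro x
    choose y hy using fun i => hpr i (p x i)
    have hy' : ∀ i, p (y i) = Pi.single i (p x i) := by
      intro i
      obtain ⟨m, hm⟩ := (y i).2
      have := hy i
      simp [pr, ← hm] at this
      rw [← hm, this]; simp
    refine ⟨(y, ⟨x - ∑ i, (y i : Q), ?_⟩), ?_⟩
    · simp [hy', Finset.univ_sum_single]
    · simp [F]
  obtain ⟨G', hG'⟩ := exists_descend F hF G (by
    rintro ⟨y, k⟩ hz
    have hz' : ∑ i, (y i : Q) + k = 0 := by simpa [F] using hz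
    have hp0 : ∑ i, p (y i) = 0 := by
      have := congrArg p hz'
      simpa using this
    have hy : ∀ i, p (y i) = 0 := by
      intro i
      apply hker i (y i)
      have := congrFun hp0 i
      rw [Finset.sum_apply, Finset.sum_eq_single i] at this
      · exact this
      · intro j _ hj
        obtain ⟨m, hm⟩ := (y j).2
        rw [← hm]; simp [Pi.single_eq_of_ne hj.symm]
      · simp
    have : (∑ i, (⟨y i, hy i⟩ : LinearMap.ker p)) + k = 0 := by
      ext; simpa using hz'
    simp only [G, LinearMap.coprod_apply, LinearMap.sum_apply, LinearMap.comp_apply,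
      LinearMap.proj_apply, LinearMap.smul_apply]
    simp_rw [fun i => hg i (y i) (hy i)]
    rw [← Finset.smul_sum, ← map_sum, ← smul_add, ← map_add, this]; simp)
  refine ⟨G', fun k => ?_⟩
  have := hG' (0, k)
  simpa [F, G] using this

lemma goodElt_ext {R : Type u} [CommRing R] {Y : Type u} [AddCommGroup Y] [Module R Y]
    {a b : R} {A E B : Type u} [AddCommGroup A] [Module R A] [AddCommGroup E] [Module R E]
    [AddCommGroup B] [Module R B] (f : A →ₗ[R] E) (g : E →ₗ[R] B) (hf : Function.Injective f)
    (hg : Function.Surjective g) (hfg : LinearMap.range f = LinearMap.ker g)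
    (hA : GoodElt R Y a A) (hB : GoodElt R Y b B) : GoodElt R Y (a * b) E := by
  intro Q _ _ p hp φ
  have hr : ∀ z : LinearMap.ker (g ∘ₗ p), p z ∈ LinearMap.range f := fun z => by
    rw [hfg]; exact z.2
  let e := LinearEquiv.ofInjective f hf
  let s : LinearMap.ker (g ∘ₗ p) →ₗ[R] A :=
    e.symm.toLinearMap ∘ₗ (p ∘ₗ (LinearMap.ker (g ∘ₗ p)).subtype).codRestrict _ hr
  have hs : ∀ z, f (s z) = p z := fun z => by
    have : e (s z) = ⟨p z, hr z⟩ := by simp [s]; rfl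
    exact congrArg Subtype.val this
  have hss : Function.Surjective s := by
    intro x
    obtain ⟨y, hy⟩ := hp (f x)
    have : f x ∈ LinearMap.ker g := hfg ▸ ⟨x, rfl⟩
    refine ⟨⟨y, by simpa [hy] using this⟩, hf ?_⟩
    rw [hs, hy]
  let t : LinearMap.ker s →ₗ[R] LinearMap.ker p :=
    ((LinearMap.ker (g ∘ₗ p)).subtype ∘ₗ (LinearMap.ker s).subtype).codRestrict _
      (fun z => by
        have := hs z.1
        rw [LinearMap.mem_ker.mp z.2, map_zero] at this
        exact this.symm)
  obtain ⟨ψ, hψ⟩ := hA _ s hss (φ ∘ₗ t)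
  obtain ⟨χ, hχ⟩ := hB _ (g ∘ₗ p) (hg.comp hp) ψ
  refine ⟨χ, fun k => ?_⟩
  have hk : (k : Q) ∈ LinearMap.ker (g ∘ₗ p) := by simp
  have hk2 : (⟨k, hk⟩ : LinearMap.ker (g ∘ₗ p)) ∈ LinearMap.ker s := by
    apply hf; rw [hs]; simp
  have h1 := hχ ⟨k, hk⟩
  have h2 := hψ ⟨⟨k, hk⟩, hk2⟩
  rw [h1, h2, smul_smul, mul_comm]; rfl

lemma goodElt_of_projective {R : Type u} [CommRing R] {Y : Type u} [AddCommGroup Y] [Module R Y]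
    {a : R} {P M : Type u} [AddCommGroup M] [Module R M] [AddCommGroup P] [Module R P]
    [Module.Projective R P]
    (p : P →ₗ[R] M) (hp : Function.Surjective p)
    (h : ∀ φ : LinearMap.ker p →ₗ[R] Y, ∃ g : P →ₗ[R] Y, ∀ k : LinearMap.ker p, g k = a • φ k) :
    GoodElt R Y a M := by
  intro Q _ _ q hq φ
  obtain ⟨l, hl⟩ := Module.projective_lifting_property q p hq
  have hl' : ∀ x, q (l x) = p x := fun x => LinearMap.congr_fun hl x
  let t : LinearMap.ker p →ₗ[R] LinearMap.ker q :=
    (l ∘ₗ (LinearMap.ker p).subtype).codRestrict _ (fun z => by simp [hl'])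
  obtain ⟨g, hg⟩ := h (φ ∘ₗ t)
  obtain ⟨G, hG⟩ := exists_descend (l.coprod (LinearMap.ker q).subtype)
    (by
      intro x
      obtain ⟨y, hy⟩ := hp (q x)
      exact ⟨(y, ⟨x - l y, by simp [hl', hy]⟩), by simp⟩)
    (g.coprod (a • φ)) (by
      rintro ⟨y, k⟩ hz
      have hz' : l y + k = 0 := by simpa using hz
      have hy : p y = 0 := by
        have := congrArg q hz'
        simpa [hl'] using this
      have h1 := hg ⟨y, hy⟩
      have h2 : t ⟨y, hy⟩ + k = 0 := by ext; exact hz'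
      simp only [LinearMap.coprod_apply, LinearMap.smul_apply]
      simp only at h1
      rw [h1, LinearMap.comp_apply, ← smul_add, ← map_add, h2]; simp)
  exact ⟨G, fun k => by simpa using hG (0, k)⟩

lemma mem_ann_homology {R : Type u} [CommRing R] (S : ShortComplex (ModuleCat.{u} R)) (a : R) :
    a ∈ Module.annihilator R S.homology ↔
      ∀ x : S.X₂, S.g x = 0 → ∃ y : S.X₁, S.f y = a • x := by
  have e : S.homology ≃ₗ[R] (LinearMap.ker S.g.hom ⧸ LinearMap.range S.moduleCatToCycles) :=
    S.moduleCatHomologyIso.toLinearEquiv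
  rw [e.annihilator_eq, Module.mem_annihilator]
  constructor
  · intro h x hx
    have := h (Submodule.Quotient.mk ⟨x, hx⟩)
    rw [← Submodule.Quotient.mk_smul, Submodule.Quotient.mk_eq_zero] at this
    obtain ⟨y, hy⟩ := this
    exact ⟨y, congrArg Subtype.val hy⟩
  · intro h z
    obtain ⟨⟨x, hx⟩, rfl⟩ := Submodule.Quotient.mk_surjective _ z
    obtain ⟨y, hy⟩ := h x hx
    rw [← Submodule.Quotient.mk_smul, Submodule.Quotient.mk_eq_zero]
    exact ⟨y, Subtype.ext hy⟩

lemma mem_extAnn_iff_res {R : Type u} [CommRing R] (M Y : Type u) [AddCommGroup M] [Module R M]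
    [AddCommGroup Y] [Module R Y] (P : ProjectiveResolution (ModuleCat.of R M)) (a : R) :
    a ∈ extAnn R 1 M Y ↔ ∀ f : P.complex.X 1 ⟶ ModuleCat.of R Y, P.complex.d 2 1 ≫ f = 0 →
      ∃ g : P.complex.X 0 ⟶ ModuleCat.of R Y, P.complex.d 1 0 ≫ g = a • f := by
  have e : ExtMod R 1 M Y ≃ₗ[R]
      ((P.complex.linearYonedaObj R (ModuleCat.of R Y)).sc' 0 1 2).homology :=
    (P.isoExt (R := R) 1 (ModuleCat.of R Y) ≪≫
      ShortComplex.homologyMapIso ((P.complex.linearYonedaObj R (ModuleCat.of R Y)).isoSc' 0 1 2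
        (by simp) (by simp))).toLinearEquiv
  rw [extAnn, e.annihilator_eq, mem_ann_homology]
  rfl

lemma mem_extAnn_iff {R : Type u} [CommRing R] (M Y : Type u) [AddCommGroup M] [Module R M]
    [AddCommGroup Y] [Module R Y] (a : R) : a ∈ extAnn R 1 M Y ↔ GoodElt R Y a M := by
  let P := projectiveResolution (ModuleCat.of R M)
  rw [mem_extAnn_iff_res M Y P]
  let p : P.complex.X 0 →ₗ[R] M := (P.π.f 0).hom
  let d1 : P.complex.X 1 →ₗ[R] P.complex.X 0 := (P.complex.d 1 0).hom
  let d2 : P.complex.X 2 →ₗ[R] P.complex.X 1 := (P.complex.d 2 1).hom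
  have hp : Function.Surjective p :=
    (ModuleCat.epi_iff_surjective (P.π.f 0)).mp inferInstance
  have h0 : LinearMap.range d1 = LinearMap.ker p := P.exact₀.moduleCat_range_eq_ker
  have h1 : LinearMap.range d2 = LinearMap.ker d1 := (P.exact_succ 0).moduleCat_range_eq_ker
  have : Module.Projective R (P.complex.X 0) :=
    (IsProjective.iff_projective (P.complex.X 0)).mpr (P.projective 0)
  let c : P.complex.X 1 →ₗ[R] LinearMap.ker p :=
    d1.codRestrict _ (fun x => h0 ▸ ⟨x, rfl⟩)
  have hc : Function.Surjective c := by
    rintro ⟨x, hx⟩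
    rw [← h0] at hx
    obtain ⟨y, hy⟩ := hx
    exact ⟨y, Subtype.ext hy⟩
  constructor
  · intro h
    refine goodElt_of_projective p hp fun φ => ?_
    obtain ⟨g, hg⟩ := h (ModuleCat.ofHom (φ ∘ₗ c)) (by
      ext x
      have : c (d2 x) = 0 := Subtype.ext (by
        change d2 x ∈ LinearMap.ker d1
        exact h1 ▸ ⟨x, rfl⟩)
      change φ (c (d2 x)) = 0
      rw [this, map_zero])
    refine ⟨g.hom, fun k => ?_⟩
    obtain ⟨x, rfl⟩ := hc k
    exact LinearMap.congr_fun (congrArg ModuleCat.Hom.hom hg) x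
  · intro h f hf
    obtain ⟨φ, hφ⟩ := exists_descend c hc f.hom (by
      intro x hx
      have : x ∈ LinearMap.ker d1 := congrArg Subtype.val hx
      rw [← h1] at this
      obtain ⟨y, rfl⟩ := this
      exact LinearMap.congr_fun (congrArg ModuleCat.Hom.hom hf) y)
    obtain ⟨g, hg⟩ := h _ p hp φ
    refine ⟨ModuleCat.ofHom g, ?_⟩
    ext x
    have := hg (c x)
    rw [hφ] at this
    exact this

lemma goodElt_addClos {R : Type u} [CommRing R] {Y : Type u} [AddCommGroup Y] [Module R Y]
    {a : R} {X : Set (ModuleCat.{u} R)} (h : ∀ N ∈ X, GoodElt R Y a N) :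
    ∀ N ∈ addClos R X, GoodElt R Y a N := by
  rintro N ⟨n, f, C, hf, ⟨e⟩⟩
  exact goodElt_of_retract (e.symm.toLinearMap ∘ₗ LinearMap.inl R N C)
    (LinearMap.fst R N C ∘ₗ e.toLinearMap) (by simp)
    (goodElt_pi (fun i => f i) fun i => h _ (hf i))

lemma ball_le_extAnn {R : Type u} [CommRing R] {Y : Type u} [AddCommGroup Y] [Module R Y]
    {X : Set (ModuleCat.{u} R)} {I : Ideal R} (h : ∀ a ∈ I, ∀ N ∈ X, GoodElt R Y a N) (r : ℕ) :
    ∀ N ∈ ball R X (r + 1), I ^ (r + 1) ≤ extAnn R 1 N Y := by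
  induction r with
  | zero =>
    intro N hN a ha
    rw [mem_extAnn_iff]
    rw [zero_add, pow_one] at ha
    exact goodElt_addClos (h a ha) N hN
  | succ r ih =>
    rintro N ⟨A, E, B, hA, hB, ⟨f, g, hf, hg, hfg⟩, C, ⟨e⟩⟩
    rw [pow_succ, Ideal.mul_le]
    intro a ha b hb
    rw [mem_extAnn_iff]
    refine goodElt_of_retract (e.symm.toLinearMap ∘ₗ LinearMap.inl R N C)
      (LinearMap.fst R N C ∘ₗ e.toLinearMap) (by simp) (goodElt_ext f g hf hg hfg ?_ ?_)
    · exact goodElt_addClos (fun N hN => (mem_extAnn_iff N Y a).mp (ih N hN ha)) A hA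
    · exact goodElt_addClos (h b hb) B hB

/-- If `M ∈ |X|_r`, then `(⋂_{X∈X} ann Ext¹(X,Y))^r ⊆ ann Ext¹(M,Y)` for every
module `Y`. -/
theorem stmt18 (R : Type u) [CommRing R] [IsNoetherianRing R] [IsLocalRing R]
    (X : Set (ModuleCat.{u} R)) (hX : ∀ N ∈ X, Module.Finite R N)
    (M : Type u) [AddCommGroup M] [Module R M] [Module.Finite R M]
    (r : ℕ) (hr : 1 ≤ r) (hM : ModuleCat.of R M ∈ ball R X r)
    (Y : Type u) [AddCommGroup Y] [Module R Y] :
    (⨅ N ∈ X, extAnn R 1 N Y) ^ r ≤ extAnn R 1 M Y := by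
  have hI : ∀ a ∈ (⨅ N ∈ X, extAnn R 1 N Y), ∀ N ∈ X, GoodElt R Y a N := by
    intro a ha N hN
    rw [← mem_extAnn_iff]
    exact (Submodule.mem_iInf _).mp ((Submodule.mem_iInf _).mp ha N) hN
  generalize (⨅ N ∈ X, extAnn R 1 N Y) = I at hI ⊢
  cases r with
  | zero => exact absurd hr (by decide)
  | succ r => exact ball_le_extAnn hI r (ModuleCat.of R M) hM
end

section
/- Let R be a local hypersurface ring (quotient of a regular local ring by a nonzerodivisor) and M a maximal Cohen–Macaulay R-module with no free summands. Then the stable annihilator of M equals ann_R Ext^2_R(M, M); in particular the Auslander–Reiten annihilator equals the stable annihilator of M. -/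
open CategoryTheory Opposite IsLocalRing

universe u

variable (R : Type u) [CommRing R]

theorem aux_reg_proj {S : Type u} [CommRing S] {x : S} (hreg : IsSMulRegular S x)
    (G : Type u) [AddCommGroup G] [Module S G] [Module.Projective S G] : IsSMulRegular G x := by
  obtain ⟨i, hi⟩ := Module.projective_def'.mp ‹Module.Projective S G›
  intro a b hab
  have hinj : Function.Injective i := Function.LeftInverse.injective (g := Finsupp.linearCombination S id)
    (fun y => LinearMap.congr_fun hi y)
  apply hinj
  ext c
  apply hreg
  have := congrArg (fun z => i z c) hab
  simpa using this

open Function in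
theorem aux_pd_lift {S : Type u} [CommRing S] [IsNoetherianRing S] [IsLocalRing S]
    (x : S) (hx : x ∈ maximalIdeal S) (hreg : IsSMulRegular S x) (n : ℕ) :
    ∀ (K : Type u) [AddCommGroup K] [Module S K] [Module.Finite S K],
      IsSMulRegular K x →
      HasProjectiveDimensionLT (ModuleCat.of (S ⧸ Ideal.span {x}) (QuotSMulTop x K)) (n + 1) →
      HasProjectiveDimensionLT (ModuleCat.of S K) (n + 1) := by
  have hne : Ideal.span {x} ≠ ⊤ := by
    rw [Ne, Ideal.span_singleton_eq_top]
    exact hx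
  have : Nontrivial (S ⧸ Ideal.span {x}) := Ideal.Quotient.nontrivial_iff.mpr hne
  have : IsLocalRing (S ⧸ Ideal.span {x}) :=
    IsLocalRing.of_surjective' (Ideal.Quotient.mk _) Ideal.Quotient.mk_surjective
  induction n with
  | zero =>
    intro K _ _ _ hK h
    simp only [zero_add, ← projective_iff_hasProjectiveDimensionLT_one,
      ← IsProjective.iff_projective] at h ⊢
    have : Module.Finite (S ⧸ Ideal.span {x}) (QuotSMulTop x K) :=
      Module.Finite.of_restrictScalars_finite S _ _
    have hfree : Module.Free (S ⧸ Ideal.span {x}) (QuotSMulTop x K) :=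
      Module.free_of_flat_of_isLocalRing
    have : Module.FinitePresentation S K := Module.finitePresentation_of_finite S K
    have : Module.Free S K := (Module.free_quotSMulTop_iff_free S K
      (by rwa [IsLocalRing.jacobson_eq_maximalIdeal _ bot_ne_top]) hK).mp hfree
    exact Module.Projective.of_free
  | succ n ih =>
    intro K _ _ _ hK h
    obtain ⟨F, _, _, _, _, f, surjf⟩ := Module.exists_finite_presentation S K
    let T : ShortComplex (ModuleCat.{u} S) := f.shortComplexKer
    have hT : T.ShortExact := LinearMap.shortExact_shortComplexKer surjf
    have hF : IsSMulRegular F x := by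
      have : Module.Projective S F := Module.Projective.of_free
      exact aux_reg_proj hreg F
    have hKer : IsSMulRegular (LinearMap.ker f) x :=
      hF.submodule _ _
    have hproj : Projective (ModuleCat.of S F) := by
      rw [← IsProjective.iff_projective]; exact Module.Projective.of_free
    refine (hT.hasProjectiveDimensionLT_X₃_iff n hproj).mpr ?_
    refine ih (LinearMap.ker f) hKer ?_
    let i : LinearMap.ker f →ₗ[S] F := (LinearMap.ker f).subtype
    have hmk : Surjective (algebraMap S (S ⧸ Ideal.span {x})) := Ideal.Quotient.mk_surjective
    let i' : QuotSMulTop x (LinearMap.ker f) →ₗ[S ⧸ Ideal.span {x}] QuotSMulTop x F :=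
      LinearMap.extendScalarsOfSurjective hmk (QuotSMulTop.map x i)
    let f' : QuotSMulTop x F →ₗ[S ⧸ Ideal.span {x}] QuotSMulTop x K :=
      LinearMap.extendScalarsOfSurjective hmk (QuotSMulTop.map x f)
    have hexact : Exact i f := LinearMap.exact_subtype_ker_map f
    have he : Exact i' f' := QuotSMulTop.map_exact x hexact surjf
    have hs : Surjective f' := QuotSMulTop.map_surjective x surjf
    have hi : Injective i' := by
      have h0 : Exact (0 : PUnit.{u+1} →ₗ[S] LinearMap.ker f) i := by
        rw [LinearMap.exact_zero_iff_injective]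
        exact Subtype.val_injective
      have := QuotSMulTop.map_first_exact_on_four_term_exact_of_isSMulRegular_last h0 hexact hK
      rw [map_zero, LinearMap.exact_zero_iff_injective] at this
      exact this
    let T' : ShortComplex (ModuleCat.{u} (S ⧸ Ideal.span {x})) :=
      ShortComplex.moduleCatMk i' f' he.linearMap_comp_eq_zero
    have hT' : T'.ShortExact :=
      { exact := by
          rw [ShortComplex.moduleCat_exact_iff_range_eq_ker]
          exact (LinearMap.exact_iff.mp he).symm
        mono_f := (ModuleCat.mono_iff_injective _).mpr hi
        epi_g := (ModuleCat.epi_iff_surjective _).mpr hs }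
    have hproj' : Projective (ModuleCat.of (S ⧸ Ideal.span {x}) (QuotSMulTop x F)) := by
      rw [← IsProjective.iff_projective]; exact Module.Projective.of_free
    exact (hT'.hasProjectiveDimensionLT_X₃_iff n hproj').mp h

theorem aux_regular (d : ℕ) : ∀ (S : Type u) [CommRing S] [IsNoetherianRing S] [IsLocalRing S]
    (s : Finset S), s.card ≤ d → Ideal.span (s : Set S) = maximalIdeal S → 
    ringKrullDim S = (d : ℕ) → 
    IsDomain S ∧ ∀ (N : Type u) [AddCommGroup N] [Module S N] [Module.Finite S N],
      HasProjectiveDimensionLT (ModuleCat.of S N) (d + 1) := by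
  induction d with
  | zero =>
    intro S _ _ _ s hs hspan hd
    have hm : maximalIdeal S = ⊥ := by
      rw [← hspan, Finset.card_eq_zero.mp (Nat.le_zero.mp hs)]; simp
    have hf : IsField S := IsLocalRing.isField_iff_maximalIdeal_eq.mpr hm
    refine ⟨hf.isDomain, ?_⟩
    intro N _ _ _
    let := hf.toField
    rw [zero_add, ← projective_iff_hasProjectiveDimensionLT_one, ← IsProjective.iff_projective]
    have : Module.Free S N := Module.Free.of_divisionRing S N
    exact Module.Projective.of_free
  | succ d ih =>
    intro S _ _ _ s hs hspan hd
    classical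
    set m := maximalIdeal S with hmdef
    -- m ≠ minimal prime
    have hmin : ∀ p ∈ minimalPrimes S, ¬ m ≤ p := by
      intro p hp hle
      have hpp : p.IsPrime := hp.1.1
      have hpm : p = m := le_antisymm (IsLocalRing.le_maximalIdeal hpp.ne_top) hle
      have h1 := IsLocalRing.maximalIdeal_height_eq_ringKrullDim (R := S)
      rw [← hmdef, ← hpm, Ideal.height_eq_zero_iff.mpr hp, hd] at h1
      norm_cast at h1
    have hm2 : ¬ m ≤ m ^ 2 := by
      intro hle
      have hm0 : m = ⊥ := by
        apply Submodule.eq_bot_of_le_smul_of_le_jacobson_bot m m (IsNoetherian.noetherian m)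
        · rwa [smul_eq_mul, ← pow_two]
        · rw [IsLocalRing.jacobson_eq_maximalIdeal _ bot_ne_top]
      obtain ⟨p, hp⟩ := Ideal.nonempty_minimalPrimes (I := (⊥ : Ideal S)) bot_ne_top
      exact hmin p hp (hm0 ▸ bot_le)
    obtain ⟨x, hxm, hx2, hxmin⟩ : ∃ x ∈ m, x ∉ m ^ 2 ∧ ∀ p ∈ minimalPrimes S, x ∉ p := by
      have hfin := minimalPrimes.finite_of_isNoetherianRing S
      have := (Ideal.subset_union_prime (s := insert (m ^ 2) hfin.toFinset) (f := id) (m ^ 2) (m ^ 2)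
        (I := m) ?_).not.mpr ?_
      · rw [Set.not_subset] at this
        obtain ⟨x, hx, hx'⟩ := this
        refine ⟨x, hx, ?_, ?_⟩
        · intro h
          exact hx' (Set.mem_biUnion (x := m ^ 2) (by simp) h)
        · intro p hp h
          exact hx' (Set.mem_biUnion (x := p) (by simp [hp]) h)
      · intro i hi h1 _
        simp only [Finset.mem_insert, h1, false_or, Set.Finite.mem_toFinset] at hi
        exact hi.1.1
      · rintro ⟨i, hi, hle⟩
        simp only [Finset.mem_insert, Set.Finite.mem_toFinset] at hi
        rcases hi with rfl | hi
        · exact hm2 hle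
        · exact hmin i hi hle
    obtain ⟨t, htc, ht⟩ : ∃ t : Finset S, t.card ≤ d ∧ Ideal.span (insert x (t : Set S)) = m := by
      have hxs : x ∈ Submodule.span S (s : Set S) := by
        have : x ∈ Ideal.span (s : Set S) := hspan ▸ hxm
        exact this
      obtain ⟨a, -, ha⟩ := Submodule.mem_span_finset.mp hxs
      have hsm : ∀ j ∈ s, j ∈ m := fun j hj => hspan ▸ Ideal.subset_span hj
      obtain ⟨j, hj, haj⟩ : ∃ j ∈ s, a j ∉ m := by
        by_contra! hcon
        apply hx2
        rw [← ha, pow_two]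
        exact Ideal.sum_mem _ fun j hj => Ideal.mul_mem_mul (hcon j hj) (hsm j hj)
      refine ⟨s.erase j, by rw [Finset.card_erase_of_mem hj]; omega, ?_⟩
      apply le_antisymm
      · rw [Ideal.span_le]
        rintro y (rfl | hy)
        · exact hxm
        · exact hsm y (Finset.mem_of_mem_erase hy)
      · rw [← hspan, Ideal.span_le]
        intro y hy
        by_cases hyj : y = j
        · subst hyj
          have hu : IsUnit (a y) := by
            by_contra h; exact haj ((IsLocalRing.mem_maximalIdeal _).mpr h)
          rw [← Finset.add_sum_erase s _ hj] at ha
          have hmem : a y * y ∈ Ideal.span (insert x ((s.erase y : Finset S) : Set S)) := by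
            have : a y * y = x - ∑ z ∈ s.erase y, a z • z := by
              rw [← ha]; simp
            rw [this]
            refine Ideal.sub_mem _ (Ideal.subset_span (Set.mem_insert _ _)) ?_
            exact Ideal.sum_mem _ fun z hz => Ideal.mul_mem_left _ _
              (Ideal.subset_span (Set.mem_insert_of_mem _ hz))
          exact (Ideal.unit_mul_mem_iff_mem _ hu).mp hmem
        · exact Ideal.subset_span (Set.mem_insert_of_mem _ (Finset.mem_erase.mpr ⟨hyj, hy⟩))
    let Q := S ⧸ Ideal.span {x}
    have hne : Ideal.span {x} ≠ ⊤ := by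
      rw [Ne, Ideal.span_singleton_eq_top]
      exact hxm
    have : Nontrivial Q := Ideal.Quotient.nontrivial_iff.mpr hne
    have : IsLocalRing Q :=
      IsLocalRing.of_surjective' (Ideal.Quotient.mk _) Ideal.Quotient.mk_surjective
    have hQm : Ideal.span ((t.image (Ideal.Quotient.mk (Ideal.span {x}))) : Set Q) = maximalIdeal Q := by
      have h1 : (maximalIdeal S).map (Ideal.Quotient.mk (Ideal.span {x})) = maximalIdeal Q :=
        IsLocalRing.map_maximalIdeal_of_surjective _ Ideal.Quotient.mk_surjective
      rw [← h1, ← hmdef, ← ht, Ideal.map_span, Set.image_insert_eq, Finset.coe_image]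
      have : Ideal.Quotient.mk (Ideal.span {x}) x = 0 :=
        Ideal.Quotient.eq_zero_iff_mem.mpr (Ideal.mem_span_singleton_self x)
      rw [this, Ideal.span_insert_zero]
    have hcard : (t.image (Ideal.Quotient.mk (Ideal.span {x}))).card ≤ d :=
      Finset.card_image_le.trans htc
    have hQd : ringKrullDim Q = d := by
      apply le_antisymm
      · refine (ringKrullDim_le_spanFinrank_maximalIdeal Q).trans ?_
        rw [← hQm]
        have h2 := Submodule.spanFinrank_span_le_ncard_of_finite (R := Q)
          (t.image (Ideal.Quotient.mk (Ideal.span {x}))).finite_toSet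
        rw [Set.ncard_coe_finset] at h2
        exact_mod_cast h2.trans hcard
      · have h3 := ringKrullDim_le_ringKrullDim_quotient_add_card ({x} : Finset S) (by
          rw [IsLocalRing.ringJacobson_eq_maximalIdeal, Finset.coe_singleton, Set.singleton_subset_iff]
          exact hxm)
        rw [hd, Finset.coe_singleton] at h3
        simp only [Finset.card_singleton, Nat.cast_add, Nat.cast_one] at h3
        exact (ENat.WithBot.add_le_add_one_right_iff).mp h3
    obtain ⟨hdom, hpd⟩ := ih Q _ hcard hQm hQd
    have hSdom : IsDomain S := by
      have hxp : (Ideal.span {x}).IsPrime := (Ideal.Quotient.isDomain_iff_prime _).mp hdom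
      obtain ⟨p, hp, hpx⟩ := Ideal.exists_minimalPrimes_le (bot_le : ⊥ ≤ Ideal.span {x})
      have hpp : p.IsPrime := hp.1.1
      have hxnp : x ∉ p := hxmin p hp
      have hp0 : p = ⊥ := by
        apply Submodule.eq_bot_of_le_smul_of_le_jacobson_bot m p (IsNoetherian.noetherian p)
        · intro y hy
          obtain ⟨z, rfl⟩ := Ideal.mem_span_singleton.mp (hpx hy)
          exact Submodule.smul_mem_smul hxm ((hpp.mem_or_mem hy).resolve_left hxnp)
        · rw [IsLocalRing.jacobson_eq_maximalIdeal _ bot_ne_top]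
      rw [hp0] at hpp
      exact IsDomain.of_bot_isPrime S
    refine ⟨hSdom, ?_⟩
    intro N _ _ _
    have hx0 : x ≠ 0 := fun h => hx2 (h ▸ Ideal.zero_mem _)
    have hxreg : IsSMulRegular S x := (IsRegular.of_ne_zero hx0).left
    obtain ⟨F, _, _, _, _, f, surjf⟩ := Module.exists_finite_presentation S N
    let T : ShortComplex (ModuleCat.{u} S) := f.shortComplexKer
    have hT : T.ShortExact := LinearMap.shortExact_shortComplexKer surjf
    have hF : IsSMulRegular F x := by
      have : Module.Projective S F := Module.Projective.of_free
      exact aux_reg_proj hxreg F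
    have hproj : Projective (ModuleCat.of S F) := by
      rw [← IsProjective.iff_projective]; exact Module.Projective.of_free
    refine (hT.hasProjectiveDimensionLT_X₃_iff d hproj).mpr ?_
    refine aux_pd_lift x hxm hxreg d (LinearMap.ker f) (hF.submodule _ _) ?_
    have : Module.Finite (S ⧸ Ideal.span {x}) (QuotSMulTop x (LinearMap.ker f)) :=
      Module.Finite.of_restrictScalars_finite S _ _
    exact hpd _

/-- pd ≤ 1 over the regular local ring -/
theorem aux_pd_le_one {R : Type u} [CommRing R] [IsNoetherianRing R] [IsLocalRing R]
    {S : Type u} [CommRing S] [IsLocalRing S] (hreg : IsRegularLocal S)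
    (f : S) [Algebra S R] (hsurj : Function.Surjective (algebraMap S R))
    (hker : RingHom.ker (algebraMap S R) = Ideal.span {f})
    (M : Type u) [AddCommGroup M] [Module R M] [Module S M] [IsScalarTower S R M]
    (hM : IsMCM R M) : HasProjectiveDimensionLT (ModuleCat.of S M) 2 := by
  obtain ⟨hnoeth, d, s, hd, hs, hspan⟩ := hreg
  obtain ⟨hfin, hdepth⟩ := hM
  have hfinS : Module.Finite S M := by
    have : Module.Finite S R := Module.Finite.of_surjective (Algebra.linearMap S R) hsurj
    exact Module.Finite.trans R M
  have hall := (aux_regular d S s hs.le hspan hd).2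
  by_cases hsub : Subsingleton M
  · have h0 : HasProjectiveDimensionLT (ModuleCat.of S M) 0 :=
      (ModuleCat.isZero_iff_subsingleton.mpr hsub).hasProjectiveDimensionLT_zero
    exact hasProjectiveDimensionLT_of_ge _ 0 2 (by omega)
  have hnt : Nontrivial M := not_subsingleton_iff_nontrivial.mp hsub
  have hfm : f ∈ maximalIdeal S := by
    rw [IsLocalRing.mem_maximalIdeal]
    intro hu
    have h1 : f ∈ RingHom.ker (algebraMap S R) := hker ▸ Ideal.mem_span_singleton_self f
    rw [RingHom.mem_ker] at h1
    exact not_isUnit_zero (h1 ▸ hu.map (algebraMap S R))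
  have hdim : (d : WithBot ℕ∞) ≤ ringKrullDim R + 1 := by
    have h3 := ringKrullDim_le_ringKrullDim_quotient_add_card ({f} : Finset S) (by
      rw [IsLocalRing.ringJacobson_eq_maximalIdeal, Finset.coe_singleton, Set.singleton_subset_iff]
      exact hfm)
    rw [hd, Finset.coe_singleton] at h3
    have e : (S ⧸ Ideal.span {f}) ≃+* R :=
      (Ideal.quotEquivOfEq hker.symm).trans (RingHom.quotientKerEquivOfSurjective hsurj)
    rw [ringKrullDim_eq_of_ringEquiv e] at h3
    simpa using h3
  obtain ⟨rs, hrs, hwr, hlen⟩ : ∃ rs : List R, (∀ r ∈ rs, r ∈ maximalIdeal R) ∧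
      RingTheory.Sequence.IsWeaklyRegular M rs ∧ d ≤ rs.length + 1 := by
    rw [← hdepth] at hdim
    have hdim' : (d : ℕ∞) ≤ moduleDepth R M + 1 := by exact_mod_cast hdim
    obtain hd1 | ⟨k, rfl⟩ : d ≤ 1 ∨ ∃ k, d = k + 2 := by
      rcases d with _ | _ | k
      · left; omega
      · left; omega
      · right; exact ⟨k, rfl⟩
    · exact ⟨[], by simp, by simp, by simpa using hd1⟩
    · have hlt : (k : ℕ∞) < moduleDepth R M := by
        generalize moduleDepth R M = D at hdim'
        cases D with
        | top => exact ENat.natCast_lt_top k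
        | coe D =>
          have h5 : k + 2 ≤ D + 1 := by exact_mod_cast hdim'
          have : k < D := by omega
          exact_mod_cast this
      obtain ⟨n, ⟨rs, h1, h2, rfl⟩, h4⟩ := lt_sSup_iff.mp hlt
      refine ⟨rs, h1, h2.1, ?_⟩
      have : k < rs.length := by exact_mod_cast h4
      omega
  obtain ⟨rs', rfl⟩ : ∃ rs' : List S, rs'.map (algebraMap S R) = rs := by
    exact List.map_surjective_iff.mpr hsurj rs
  rw [RingTheory.Sequence.isWeaklyRegular_map_algebraMap_iff] at hwr
  have hmem : ∀ r ∈ rs', r ∈ maximalIdeal S := by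
    intro r hr
    have := hrs _ (List.mem_map_of_mem hr)
    rw [IsLocalRing.mem_maximalIdeal] at this ⊢
    exact fun hu => this (hu.map _)
  have heq := ModuleCat.projectiveDimension_quotient_eq_add_length_of_isWeaklyRegular
    (ModuleCat.of S M) rs' hwr hmem
  have hle := hall (M ⧸ Ideal.ofList rs' • (⊤ : Submodule S M))
  rw [← projectiveDimension_lt_iff] at hle ⊢
  erw [heq] at hle
  rw [List.length_map] at hlen
  generalize projectiveDimension (ModuleCat.of S M) = D at hle
  induction D using WithBot.recBotCoe with
  | bot => exact WithBot.bot_lt_coe _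
  | coe D =>
    cases D with
    | top =>
      refine absurd hle ?_
      have h7 : ((⊤ : ℕ∞) : WithBot ℕ∞) + ((rs'.length : ℕ) : WithBot ℕ∞) = ((⊤ : ℕ∞) : WithBot ℕ∞) := by
        rw [← WithBot.coe_natCast, ← WithBot.coe_add, top_add]
      rw [h7]
      simp
    | coe D =>
      have h6 : D + rs'.length < d + 1 := by exact_mod_cast hle
      have : D < 2 := by omega
      have h8 : (D : ℕ∞) < ((2 : ℕ) : ℕ∞) := Nat.cast_lt.mpr this
      exact WithBot.coe_lt_coe.mpr h8

open TensorProduct Function in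
/-- The periodicity exact sequence. -/
theorem aux_periodic {R : Type u} [CommRing R]
    {S : Type u} [CommRing S] (f : S) (hf : f ∈ nonZeroDivisors S)
    [Algebra S R] (hsurj : Function.Surjective (algebraMap S R))
    (hker : RingHom.ker (algebraMap S R) = Ideal.span {f})
    (M : Type u) [AddCommGroup M] [Module R M] [Module S M] [IsScalarTower S R M]
    (hM : HasProjectiveDimensionLT (ModuleCat.of S M) 2) :
    ∃ (F1 F0 : Type u) (_ : AddCommGroup F1) (_ : AddCommGroup F0) (_ : Module R F1)
      (_ : Module R F0) (i : M →ₗ[R] F1) (δ : F1 →ₗ[R] F0) (p : F0 →ₗ[R] M),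
      Module.Projective R F1 ∧ Module.Projective R F0 ∧ Injective i ∧ Exact i δ ∧ Exact δ p ∧
        Surjective p := by
  let p : (M →₀ S) →ₗ[S] M := Finsupp.linearCombination S id
  have hp : Surjective p := Finsupp.linearCombination_id_surjective S M
  let T : ShortComplex (ModuleCat.{u} S) := p.shortComplexKer
  have hT : T.ShortExact := LinearMap.shortExact_shortComplexKer hp
  have hproj : Projective (ModuleCat.of S (M →₀ S)) := by
    rw [← IsProjective.iff_projective]; infer_instance
  have hK : Module.Projective S (LinearMap.ker p) := by
    have := (hT.hasProjectiveDimensionLT_X₃_iff 0 hproj).mp hM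
    rw [zero_add, ← projective_iff_hasProjectiveDimensionLT_one,
      ← IsProjective.iff_projective] at this
    exact this
  generalize hG1 : LinearMap.ker p = G1 at hK
  have hfreg : IsSMulRegular S f := fun a b hab => (mul_cancel_left_mem_nonZeroDivisors hf).mp hab
  have hregG0 : IsSMulRegular (M →₀ S) f := aux_reg_proj hfreg _
  have hfR : algebraMap S R f = 0 := by
    rw [← RingHom.mem_ker, hker]; exact Ideal.mem_span_singleton_self f
  have hfM : ∀ m : M, f • m = 0 := fun m => by
    rw [← algebraMap_smul R f m, hfR, zero_smul]
  -- kernel of `G → R ⊗ G`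
  have hkerT : ∀ (G : Type u) [AddCommGroup G] [Module S G] (g : G),
      (1 : R) ⊗ₜ[S] g = 0 → ∃ g', g = f • g' := by
    intro G _ _ g hg
    have hex : Exact (LinearMap.toSpanSingleton S S f) (Algebra.linearMap S R) := by
      intro s
      have : Algebra.linearMap S R s = 0 ↔ s ∈ RingHom.ker (algebraMap S R) := Iff.rfl
      rw [this, hker, Ideal.mem_span_singleton']
      rfl
    have h2 := rTensor_exact G hex hsurj
    obtain ⟨z, hz⟩ := (h2 ((1 : S) ⊗ₜ[S] g)).mp (by simpa using hg)
    obtain ⟨g', rfl⟩ := (TensorProduct.lid S G).symm.surjective z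
    refine ⟨g', ?_⟩
    have := congrArg (TensorProduct.lid S G) hz
    simpa using this.symm
  have hsurjT : ∀ (G : Type u) [AddCommGroup G] [Module S G] (y : R ⊗[S] G),
      ∃ g : G, y = (1 : R) ⊗ₜ[S] g := by
    intro G _ _ y
    induction y with
    | zero => exact ⟨0, by simp⟩
    | add a b ha hb =>
      obtain ⟨a, rfl⟩ := ha
      obtain ⟨b, rfl⟩ := hb
      exact ⟨a + b, by rw [tmul_add]⟩
    | tmul r g =>
      obtain ⟨s, rfl⟩ := hsurj r
      exact ⟨s • g, by rw [Algebra.algebraMap_eq_smul_one, smul_tmul]⟩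
  have hfT : ∀ (G : Type u) [AddCommGroup G] [Module S G] (g : G),
      (1 : R) ⊗ₜ[S] (f • g) = 0 := by
    intro G _ _ g
    rw [← smul_tmul, ← Algebra.algebraMap_eq_smul_one, hfR, zero_tmul]
  -- the map `G0 → G1`
  let q : (M →₀ S) →ₗ[S] G1 := LinearMap.codRestrict G1 (LinearMap.lsmul S _ f) (by
    intro g
    rw [← hG1, LinearMap.mem_ker]
    simp [hfM])
  have hq : ∀ g, ((q g : G1) : M →₀ S) = f • g := fun g => rfl
  let φ : (M →₀ S) →ₗ[S] R ⊗[S] G1 := (TensorProduct.mk S R G1 1) ∘ₗ q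
  have hφ : LinearMap.ker p ≤ LinearMap.ker φ := by
    intro g hg
    rw [hG1] at hg
    rw [LinearMap.mem_ker]
    change (1 : R) ⊗ₜ[S] (q g) = 0
    have : q g = f • (⟨g, hg⟩ : G1) := Subtype.ext rfl
    rw [this]
    exact hfT G1 _
  let i0 : M →ₗ[S] R ⊗[S] G1 :=
    ((LinearMap.ker p).liftQ φ hφ) ∘ₗ (p.quotKerEquivOfSurjective hp).symm.toLinearMap
  have hi0 : ∀ g, i0 (p g) = (1 : R) ⊗ₜ[S] (q g) := by
    intro g
    have : (p.quotKerEquivOfSurjective hp).symm (p g) = Submodule.Quotient.mk g := by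
      rw [LinearEquiv.symm_apply_eq]; rfl
    simp only [i0, LinearMap.comp_apply, LinearEquiv.coe_coe, this]
    rfl
  refine ⟨R ⊗[S] G1, R ⊗[S] (M →₀ S), inferInstance, inferInstance, inferInstance, inferInstance,
    i0.extendScalarsOfSurjective hsurj, G1.subtype.baseChange R, p.liftBaseChange R,
    inferInstance, inferInstance, ?_, ?_, ?_, ?_⟩
  · rw [injective_iff_map_eq_zero]
    intro m hm
    obtain ⟨g, rfl⟩ := hp m
    replace hm : i0 (p g) = 0 := hm
    rw [hi0] at hm
    obtain ⟨g', hg'⟩ := hkerT G1 (q g) hm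
    have : g = g' := hregG0 (congrArg Subtype.val hg')
    rw [this, ← LinearMap.mem_ker, hG1]
    exact g'.2
  · intro y
    constructor
    · intro hy
      obtain ⟨g, rfl⟩ := hsurjT G1 y
      rw [LinearMap.baseChange_tmul] at hy
      obtain ⟨g', hg'⟩ := hkerT _ _ hy
      refine ⟨p g', ?_⟩
      change i0 (p g') = _
      rw [hi0]
      congr 1
      exact Subtype.ext hg'.symm
    · rintro ⟨m, rfl⟩
      obtain ⟨g, rfl⟩ := hp m
      change (G1.subtype.baseChange R) (i0 (p g)) = 0
      rw [hi0, LinearMap.baseChange_tmul]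
      exact hfT _ g
  · intro y
    obtain ⟨g, rfl⟩ := hsurjT _ y
    rw [LinearMap.liftBaseChange_tmul, one_smul]
    constructor
    · intro hg
      rw [← LinearMap.mem_ker, hG1] at hg
      exact ⟨1 ⊗ₜ ⟨g, hg⟩, by rw [LinearMap.baseChange_tmul]; rfl⟩
    · rintro ⟨z, hz⟩
      obtain ⟨g1, rfl⟩ := hsurjT G1 z
      rw [LinearMap.baseChange_tmul] at hz
      have h1 : (1 : R) ⊗ₜ[S] (g - g1.1) = 0 := by rw [tmul_sub, ← hz]; simp
      obtain ⟨g', hg'⟩ := hkerT _ _ h1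
      have h2 : p g1.1 = 0 := LinearMap.mem_ker.mp (hG1.ge g1.2)
      have : g = g1.1 + f • g' := by rw [← hg']; abel
      rw [this, map_add, h2, map_smul, hfM, add_zero]
  · intro m
    obtain ⟨g, rfl⟩ := hp m
    exact ⟨1 ⊗ₜ g, by rw [LinearMap.liftBaseChange_tmul, one_smul]⟩

theorem aux_homology_ann {R : Type u} [CommRing R] (T : ShortComplex (ModuleCat.{u} R)) (a : R) :
    a ∈ Module.annihilator R T.homology ↔
      ∀ x : T.X₂, T.g x = 0 → ∃ y : T.X₁, a • x = T.f y := by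
  rw [LinearEquiv.annihilator_eq T.moduleCatHomologyIso.toLinearEquiv, Module.mem_annihilator]
  constructor
  · intro h x hx
    have h1 := h (Submodule.Quotient.mk (⟨x, hx⟩ : LinearMap.ker T.g.hom))
    erw [← Submodule.Quotient.mk_smul, Submodule.Quotient.mk_eq_zero] at h1
    obtain ⟨y, hy⟩ := h1
    exact ⟨y, (congrArg Subtype.val hy).symm⟩
  · intro h z
    obtain ⟨⟨x, hx⟩, rfl⟩ := Submodule.Quotient.mk_surjective _ z
    obtain ⟨y, hy⟩ := h x hx
    erw [← Submodule.Quotient.mk_smul, Submodule.Quotient.mk_eq_zero]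
    exact ⟨y, Subtype.ext hy.symm⟩

theorem aux_mem_extAnn {R : Type u} [CommRing R] (M N : Type u) [AddCommGroup M] [Module R M]
    [AddCommGroup N] [Module R N] (P : ProjectiveResolution (ModuleCat.of R M)) (n : ℕ) (a : R) :
    a ∈ extAnn R (n + 1) M N ↔ ∀ g : P.complex.X (n + 1) ⟶ ModuleCat.of R N,
      P.complex.d (n + 2) (n + 1) ≫ g = 0 →
        ∃ h : P.complex.X n ⟶ ModuleCat.of R N, a • g = P.complex.d (n + 1) n ≫ h := by
  unfold extAnn ExtMod
  rw [LinearEquiv.annihilator_eq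
    (P.isoExt (R := R) (n + 1) (ModuleCat.of R N)).toLinearEquiv]
  have e := (P.complex.linearYonedaObj R (ModuleCat.of R N)).homologyIsoSc' n (n + 1) (n + 2)
    (by simp) (by simp)
  rw [LinearEquiv.annihilator_eq e.toLinearEquiv, aux_homology_ann]
  exact Iff.rfl

theorem aux_FT_extAnn {R : Type u} [CommRing R] (M N : Type u) [AddCommGroup M] [Module R M]
    [AddCommGroup N] [Module R N] (a : R) (F : Type u) [AddCommGroup F] [Module R F]
    [Module.Projective R F] (g : M →ₗ[R] F) (h : F →ₗ[R] M) (hgh : ∀ m, h (g m) = a • m) (n : ℕ) :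
    a ∈ extAnn R (n + 1) M N := by
  let P := projectiveResolution (ModuleCat.of R M)
  rw [aux_mem_extAnn M N P]
  intro c hc
  have hF : Projective (ModuleCat.of R F) := by
    rw [← IsProjective.iff_projective]; infer_instance
  let Q := ProjectiveResolution.self (ModuleCat.of R F)
  let α : P.complex ⟶ P.complex := a • 𝟙 _
  let β : P.complex ⟶ P.complex := ProjectiveResolution.lift (ModuleCat.ofHom g) P Q ≫
    ProjectiveResolution.lift (ModuleCat.ofHom h) Q P
  have hgh' : ModuleCat.ofHom g ≫ ModuleCat.ofHom h = a • 𝟙 (ModuleCat.of R M) := by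
    ext m; exact hgh m
  have hs : (ChainComplex.single₀ (ModuleCat.{u} R)).map (a • 𝟙 (ModuleCat.of R M)) =
      a • 𝟙 _ := by
    apply HomologicalComplex.from_single_hom_ext
    simp
    rfl
  let s : Homotopy α β := ProjectiveResolution.liftHomotopy
    (ModuleCat.ofHom g ≫ ModuleCat.ofHom h) α β (by
      rw [hgh', hs]; simp [α]) (by simp [β])
  have hz : β.f (n + 1) = 0 := by
    have : Limits.IsZero (Q.complex.X (n + 1)) := HomologicalComplex.isZero_single_obj_X
      (ComplexShape.down ℕ) 0 (ModuleCat.of R F) (n + 1) (by simp)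
    simp only [β, HomologicalComplex.comp_f]
    rw [this.eq_of_tgt ((ProjectiveResolution.lift (ModuleCat.ofHom g) P Q).f (n + 1)) 0]
    simp
  have hcomm := s.comm (n + 1)
  rw [hz, add_zero, Homotopy.dNext_succ_chainComplex, Homotopy.prevD_chainComplex] at hcomm
  refine ⟨s.hom n (n + 1) ≫ c, ?_⟩
  have h2 : α.f (n + 1) ≫ c = a • c := by simp [α]
  rw [← h2, hcomm, Preadditive.add_comp, Category.assoc, Category.assoc, hc]
  simp

open Function in
theorem aux_data {R : Type u} [CommRing R] (M : Type u) [AddCommGroup M] [Module R M] :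
    ∃ (X : ℕ → ModuleCat.{u} R) (d : ∀ n, X (n + 1) →ₗ[R] X n) (ε : X 0 →ₗ[R] M),
      (∀ n, Module.Projective R (X n)) ∧ (∀ n, Exact (d (n + 1)) (d n)) ∧ Exact (d 0) ε ∧
      Surjective ε ∧
      ∀ (N : Type u) [AddCommGroup N] [Module R N] (n : ℕ) (a : R),
        a ∈ extAnn R (n + 1) M N ↔ ∀ g : X (n + 1) →ₗ[R] N, g ∘ₗ d (n + 1) = 0 →
          ∃ h : X n →ₗ[R] N, a • g = h ∘ₗ d n := by
  let P := projectiveResolution (ModuleCat.of R M)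
  refine ⟨P.complex.X, fun n => (P.complex.d (n + 1) n).hom, (P.π.f 0).hom, ?_, ?_, ?_, ?_, ?_⟩
  · intro n
    rw [IsProjective.iff_projective]
    exact P.projective n
  · intro n
    exact (ShortComplex.ShortExact.moduleCat_exact_iff_function_exact _).mp (P.exact_succ n)
  · exact (ShortComplex.ShortExact.moduleCat_exact_iff_function_exact _).mp P.exact₀
  · exact (ModuleCat.epi_iff_surjective (P.π.f 0)).mp inferInstance
  · intro N _ _ n a
    rw [aux_mem_extAnn M N P]
    constructor
    · intro h g hg
      obtain ⟨k, hk⟩ := h (ModuleCat.ofHom g) (by ext x; exact LinearMap.congr_fun hg x)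
      exact ⟨k.hom, congrArg ModuleCat.Hom.hom hk⟩
    · intro h g hg
      obtain ⟨k, hk⟩ := h g.hom (congrArg ModuleCat.Hom.hom hg)
      exact ⟨ModuleCat.ofHom k, ModuleCat.hom_ext hk⟩

theorem aux_lift {R : Type u} [CommRing R] {P A B : Type u} [AddCommGroup P] [Module R P]
    [AddCommGroup A] [Module R A] [AddCommGroup B] [Module R B] [Module.Projective R P]
    (φ : A →ₗ[R] B) (t : P →ₗ[R] B) (h : ∀ x, ∃ y, φ y = t x) :
    ∃ l : P →ₗ[R] A, ∀ x, φ (l x) = t x := by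
  obtain ⟨l, hl⟩ := Module.projective_lifting_property φ.rangeRestrict
    (t.codRestrict (LinearMap.range φ) (fun x => h x)) φ.surjective_rangeRestrict
  exact ⟨l, fun x => congrArg Subtype.val (LinearMap.congr_fun hl x)⟩

theorem aux_desc {R : Type u} [CommRing R] {A B N : Type u} [AddCommGroup A] [Module R A]
    [AddCommGroup B] [Module R B] [AddCommGroup N] [Module R N]
    (ε : A →ₗ[R] B) (hε : Function.Surjective ε) (t : A →ₗ[R] N) (h : ∀ x, ε x = 0 → t x = 0) :
    ∃ k : B →ₗ[R] N, ∀ x, k (ε x) = t x := by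
  refine ⟨((LinearMap.ker ε).liftQ t (fun x hx => h x hx)) ∘ₗ
    (ε.quotKerEquivOfSurjective hε).symm.toLinearMap, fun x => ?_⟩
  have : (ε.quotKerEquivOfSurjective hε).symm (ε x) = Submodule.Quotient.mk x := by
    rw [LinearEquiv.symm_apply_eq]; rfl
  simp only [LinearMap.comp_apply, LinearEquiv.coe_coe, this]
  rfl

open Function in
theorem aux_ext_one {R : Type u} [CommRing R] (M K F : Type u) [AddCommGroup M] [Module R M]
    [AddCommGroup K] [Module R K] [AddCommGroup F] [Module R F]
    (ι : K →ₗ[R] F) (π : F →ₗ[R] M) (hι : Injective ι) (hπ : Surjective π) (hex : Exact ι π)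
    (a : R) (ha : a ∈ extAnn R 1 M K) :
    ∃ g : M →ₗ[R] F, ∀ m, π (g m) = a • m := by
  obtain ⟨X, d, ε, hX, hd, hdε, hε, hext⟩ := aux_data (R := R) M
  obtain ⟨u0, hu0⟩ := aux_lift (P := X 0) π ε (fun x => hπ _)
  obtain ⟨u1, hu1⟩ := aux_lift (P := X 1) ι (u0 ∘ₗ d 0) (fun x => by
    rw [← Set.mem_range, ← hex, LinearMap.comp_apply, hu0]
    exact hdε.apply_apply_eq_zero x)
  obtain ⟨h, hh⟩ := (hext K 0 a).mp ha u1 (by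
    ext x
    apply hι
    rw [LinearMap.comp_apply, hu1, LinearMap.comp_apply, (hd 0).apply_apply_eq_zero]
    simp)
  obtain ⟨k, hk⟩ := aux_desc ε hε (a • u0 - ι ∘ₗ h) (fun x hx => by
    obtain ⟨y, rfl⟩ := (hdε x).mp hx
    have := LinearMap.congr_fun hh y
    simp only [LinearMap.smul_apply, LinearMap.comp_apply] at this
    simp only [LinearMap.sub_apply, LinearMap.smul_apply, LinearMap.comp_apply]
    rw [← this, map_smul, hu1, LinearMap.comp_apply, sub_self])
  refine ⟨k, fun m => ?_⟩
  obtain ⟨x, rfl⟩ := hε m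
  rw [hk]
  simp [hu0, hex.apply_apply_eq_zero]

open Function in
theorem aux_ext_two {R : Type u} [CommRing R] (M F1 F0 : Type u) [AddCommGroup M] [Module R M]
    [AddCommGroup F1] [Module R F1] [AddCommGroup F0] [Module R F0]
    [Module.Projective R F1] [Module.Projective R F0]
    (i : M →ₗ[R] F1) (δ : F1 →ₗ[R] F0) (p : F0 →ₗ[R] M) (hi : Injective i) (hiδ : Exact i δ)
    (hδp : Exact δ p) (hp : Surjective p) (a : R) (ha : a ∈ extAnn R 2 M M) :
    ∃ k : F1 →ₗ[R] M, ∀ m, k (i m) = a • m := by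
  obtain ⟨X, d, ε, hX, hd, hdε, hε, hext⟩ := aux_data (R := R) M
  obtain ⟨u0, hu0⟩ := aux_lift (P := X 0) p ε (fun x => hp _)
  obtain ⟨u1, hu1⟩ := aux_lift (P := X 1) δ (u0 ∘ₗ d 0) (fun x => by
    rw [← Set.mem_range, ← hδp, LinearMap.comp_apply, hu0]
    exact hdε.apply_apply_eq_zero x)
  obtain ⟨u2, hu2⟩ := aux_lift (P := X 2) i (u1 ∘ₗ d 1) (fun x => by
    rw [← Set.mem_range, ← hiδ, LinearMap.comp_apply, hu1, LinearMap.comp_apply,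
      (hd 0).apply_apply_eq_zero, map_zero])
  simp only [LinearMap.comp_apply] at hu1 hu2
  obtain ⟨h, hh⟩ := (hext M 1 a).mp ha u2 (by
    ext x
    apply hi
    rw [LinearMap.comp_apply, hu2, (hd 1).apply_apply_eq_zero]
    simp)
  have hw : ∀ y, d 0 y = 0 → a • u1 y = i (h y) := by
    intro y hy
    obtain ⟨z, rfl⟩ := (hd 0 y).mp hy
    have := LinearMap.congr_fun hh z
    simp only [LinearMap.smul_apply, LinearMap.comp_apply] at this
    rw [← hu2, ← map_smul, this]
  obtain ⟨v0, hv0⟩ := aux_lift (P := F0) ε p (fun x => hε _)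
  obtain ⟨v1, hv1⟩ := aux_lift (P := F1) (d 0) (v0 ∘ₗ δ) (fun x => by
    rw [← Set.mem_range, ← hdε, LinearMap.comp_apply, hv0]
    exact hδp.apply_apply_eq_zero x)
  simp only [LinearMap.comp_apply] at hv1
  obtain ⟨c, hc⟩ := aux_lift (P := F0) δ (LinearMap.id - u0 ∘ₗ v0) (fun x => by
    rw [← Set.mem_range, ← hδp]
    simp [hu0, hv0])
  simp only [LinearMap.sub_apply, LinearMap.comp_apply, LinearMap.id_apply] at hc
  -- the correction lands in the image of `i`
  obtain ⟨k, hk⟩ := aux_lift (P := F1) i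
    (a • LinearMap.id - (a • u1 - i ∘ₗ h) ∘ₗ v1 - a • (c ∘ₗ δ)) (fun x => by
    rw [← Set.mem_range, ← hiδ]
    simp [hu1, hv1, hc, hiδ.apply_apply_eq_zero, smul_sub])
  refine ⟨k, fun m => hi ?_⟩
  rw [hk]
  have h0 : δ (i m) = 0 := hiδ.apply_apply_eq_zero m
  have h1 : d 0 (v1 (i m)) = 0 := by rw [hv1, h0, map_zero]
  simp [h0, hw _ h1]

theorem aux_prod {R : Type u} [CommRing R] (M : Type u) [AddCommGroup M] [Module R M] (a : R)
    (ha : a ∈ extAnn R 2 M (M × R)) : a ∈ extAnn R 2 M M := by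
  obtain ⟨X, d, ε, hX, hd, hdε, hε, hext⟩ := aux_data (R := R) M
  refine (hext M 1 a).mpr fun g hg => ?_
  obtain ⟨h, hh⟩ := (hext (M × R) 1 a).mp ha (LinearMap.inl R M R ∘ₗ g) (by
    rw [LinearMap.comp_assoc, hg, LinearMap.comp_zero])
  refine ⟨LinearMap.fst R M R ∘ₗ h, ?_⟩
  ext x
  have := congrArg Prod.fst (LinearMap.congr_fun hh x)
  simpa using this

/-- Over a local hypersurface ring `R ≅ S/(f)`, for a maximal Cohen–Macaulay module
`M` with no free summands, the stable annihilator equals `ann Ext²(M,M)`, and the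
Auslander–Reiten annihilator equals the stable annihilator. -/
theorem stmt19 (R : Type u) [CommRing R] [IsNoetherianRing R] [IsLocalRing R]
    (S : Type u) [CommRing S] [IsLocalRing S] (hreg : IsRegularLocal S)
    (f : S) (hf : f ∈ nonZeroDivisors S)
    (hhyp : Nonempty (R ≃+* S ⧸ Ideal.span {f}))
    (M ΩM : Type u) [AddCommGroup M] [Module R M] [AddCommGroup ΩM] [Module R ΩM]
    (hM : IsMCM R M)
    (hnofree : ¬ ∃ (N : Type u) (_ : AddCommGroup N) (_ : Module R N),
      Nonempty (M ≃ₗ[R] N × R))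
    (hΩ : IsSyzygy R M ΩM) :
    extAnn R 1 M ΩM = extAnn R 2 M M ∧ ARann R M = extAnn R 1 M ΩM := by
  obtain ⟨e⟩ := hhyp
  let _ : Algebra S R := RingHom.toAlgebra
    ((e.symm : (S ⧸ Ideal.span {f}) →+* R).comp (Ideal.Quotient.mk (Ideal.span {f})))
  have hsurj : Function.Surjective (algebraMap S R) :=
    e.symm.surjective.comp Ideal.Quotient.mk_surjective
  have hker : RingHom.ker (algebraMap S R) = Ideal.span {f} := by
    ext s
    rw [RingHom.mem_ker, ← Ideal.Quotient.eq_zero_iff_mem]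
    exact e.symm.map_eq_zero_iff
  let _ : Module S M := Module.compHom M (algebraMap S R)
  have : IsScalarTower S R M := IsScalarTower.of_algebraMap_smul fun _ _ => rfl
  have hpd := aux_pd_le_one hreg f hsurj hker M hM
  obtain ⟨F1, F0, _, _, _, _, i, δ, p, hF1, hF0, hi, hiδ, hδp, hp⟩ :=
    aux_periodic f hf hsurj hker M hpd
  obtain ⟨F, _, _, ι, π, hfree, _, hι, hπ, hιπ⟩ := hΩ
  have hex : Function.Exact ι π := LinearMap.exact_iff.mpr hιπ.symm
  have h1 : ∀ a ∈ extAnn R 1 M ΩM, ∀ (N : Type u) [AddCommGroup N] [Module R N] (n : ℕ),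
      a ∈ extAnn R (n + 1) M N := by
    intro a ha N _ _ n
    obtain ⟨g, hg⟩ := aux_ext_one M ΩM F ι π hι hπ hex a ha
    exact aux_FT_extAnn M N a F g π hg n
  have h2 : ∀ a ∈ extAnn R 2 M M, a ∈ extAnn R 1 M ΩM := by
    intro a ha
    obtain ⟨k, hk⟩ := aux_ext_two M F1 F0 i δ p hi hiδ hδp hp a ha
    exact aux_FT_extAnn M ΩM a F1 i k hk 0
  refine ⟨le_antisymm (fun a ha => h1 a ha M 1) h2, le_antisymm (fun a ha => ?_) (fun a ha => ?_)⟩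
  · exact h2 a (aux_prod M a ((Submodule.mem_iInf _).mp ha 1))
  · exact (Submodule.mem_iInf _).mpr fun n => h1 a ha (M × R) n
end
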